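/- Theorem 4.1(ii), first case: Suppose the symmetric, measurable, uniformly elliptic coefficients a^{ij} on ℝ^{d+1} are independent of x', i.e. a^{ij}(t,x',x'') = a^{ij}(t,y',x'') for all t, x', y', x''. Let δ ∈ (0,1), let f satisfy [f]_{x',δ;Q_1} < ∞, and let u be a bounded classical solution of u_t − a^{ij}D_{ij}u = f in the parabolic cylinder Q_1 = (−1,0)×B_1. Then there is a constant N depending only on d, q, δ, ν such that [u]_{x',2+δ;Q_{1/2}} ≤ N ( [f]_{x',δ;Q_1} + sup_{Q_1}|u| ). -/

import Mathlib

open MeasureTheory Metric Set Filter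

noncomputable section

/-- Spatial first-order partial derivative `D_i`. -/
def sd {d : ℕ} (i : Fin d) (v : EuclideanSpace ℝ (Fin d) → ℝ)
    (x : EuclideanSpace ℝ (Fin d)) : ℝ :=
  fderiv ℝ v x (EuclideanSpace.single i 1)

/-- Spatial second-order partial derivative `D_i D_j`. -/
def sd2 {d : ℕ} (i j : Fin d) (v : EuclideanSpace ℝ (Fin d) → ℝ)
    (x : EuclideanSpace ℝ (Fin d)) : ℝ :=
  sd i (fun y => sd j v y) x

/-- Time derivative `∂_t`. -/
def td {d : ℕ} (u : ℝ → EuclideanSpace ℝ (Fin d) → ℝ) (t : ℝ)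
    (x : EuclideanSpace ℝ (Fin d)) : ℝ :=
  deriv (fun s => u s x) t

/-- Parabolic cylinder `Q_ρ = (-ρ², 0) × B_ρ`. -/
def parQ (d : ℕ) (ρ : ℝ) : Set (ℝ × EuclideanSpace ℝ (Fin d)) :=
  Ioo (-(ρ ^ 2)) 0 ×ˢ ball (0 : EuclideanSpace ℝ (Fin d)) ρ

/-- The half space `ℝ^{d+1}_0 = (-∞, 0) × ℝ^d`. -/
def parNeg (d : ℕ) : Set (ℝ × EuclideanSpace ℝ (Fin d)) :=
  Iio (0 : ℝ) ×ˢ (univ : Set (EuclideanSpace ℝ (Fin d)))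

/-- Partial Hölder bound in the first `q` spatial coordinates `x'`. -/
def PHolderXPar (d q : ℕ) (δ : ℝ) (Q : Set (ℝ × EuclideanSpace ℝ (Fin d)))
    (g : ℝ → EuclideanSpace ℝ (Fin d) → ℝ) (K : ℝ) : Prop :=
  ∀ (t : ℝ) (x y : EuclideanSpace ℝ (Fin d)), (t, x) ∈ Q → (t, y) ∈ Q →
    (∀ i : Fin d, q ≤ (i : ℕ) → x i = y i) → |g t x - g t y| ≤ K * dist x y ^ δ

/-- Full spatial Hölder bound. -/
def HolderXPar (d : ℕ) (δ : ℝ) (Q : Set (ℝ × EuclideanSpace ℝ (Fin d)))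
    (g : ℝ → EuclideanSpace ℝ (Fin d) → ℝ) (K : ℝ) : Prop :=
  ∀ (t : ℝ) (x y : EuclideanSpace ℝ (Fin d)), (t, x) ∈ Q → (t, y) ∈ Q →
    |g t x - g t y| ≤ K * dist x y ^ δ

/-- Hölder bound in the time variable `t`, with exponent `γ`. -/
def HolderTPar (d : ℕ) (γ : ℝ) (Q : Set (ℝ × EuclideanSpace ℝ (Fin d)))
    (g : ℝ → EuclideanSpace ℝ (Fin d) → ℝ) (K : ℝ) : Prop :=
  ∀ (t s : ℝ) (x : EuclideanSpace ℝ (Fin d)), (t, x) ∈ Q → (s, x) ∈ Q →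
    |g t x - g s x| ≤ K * |t - s| ^ γ

/-- Classical regularity of parabolic solutions: `u`, `∂_t u`, `Du`, `D²u` exist and are
continuous on `Q`. -/
def ParClassical {d : ℕ} (Q : Set (ℝ × EuclideanSpace ℝ (Fin d)))
    (u : ℝ → EuclideanSpace ℝ (Fin d) → ℝ) : Prop :=
  (∀ z ∈ Q, DifferentiableAt ℝ (fun s => u s z.2) z.1) ∧
  (∀ z ∈ Q, ContDiffAt ℝ 2 (u z.1) z.2) ∧
  ContinuousOn (fun z : ℝ × EuclideanSpace ℝ (Fin d) => u z.1 z.2) Q ∧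
  ContinuousOn (fun z : ℝ × EuclideanSpace ℝ (Fin d) => td u z.1 z.2) Q ∧
  (∀ i : Fin d,
    ContinuousOn (fun z : ℝ × EuclideanSpace ℝ (Fin d) => sd i (u z.1) z.2) Q) ∧
  (∀ i j : Fin d,
    ContinuousOn (fun z : ℝ × EuclideanSpace ℝ (Fin d) => sd2 i j (u z.1) z.2) Q)

/-- Uniform ellipticity with constant `ν` (parabolic, two-sided bound). -/
def UnifEllipticP (d : ℕ) (ν : ℝ)
    (a : Fin d → Fin d → ℝ → EuclideanSpace ℝ (Fin d) → ℝ) : Prop :=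
  ∀ (t : ℝ) (x : EuclideanSpace ℝ (Fin d)) (ξ : Fin d → ℝ),
    ν * ∑ i, ξ i ^ 2 ≤ ∑ i, ∑ j, a i j t x * ξ i * ξ j ∧
      ∑ i, ∑ j, a i j t x * ξ i * ξ j ≤ ν⁻¹ * ∑ i, ξ i ^ 2

/-- Symmetric second difference quotient at `0` converges to `c`. -/
def SymD2 (h : ℝ → ℝ) (c : ℝ) : Prop :=
  Tendsto (fun s : ℝ => (h s + h (-s) - 2 * h 0) / s ^ 2) (nhdsWithin 0 (Ioi 0)) (nhds c)

lemma symD2_of_deriv {h h' : ℝ → ℝ} {c : ℝ}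
    (h1 : ∀ᶠ τ in nhds (0 : ℝ), HasDerivAt h (h' τ) τ) (h2 : HasDerivAt h' c 0) :
    SymD2 h c := by
  have hneg : Tendsto (fun s : ℝ => -s) (nhds 0) (nhds 0) := by
    simpa using (continuous_neg (G := ℝ)).tendsto 0
  have h1' := hneg.eventually h1
  unfold SymD2
  apply HasDerivAt.lhopital_zero_nhdsGT (f' := fun s => h' s - h' (-s)) (g' := fun s => 2 * s)
  · apply Filter.Eventually.filter_mono nhdsWithin_le_nhds
    filter_upwards [h1, h1'] with s hs hs'
    have := hs'.scomp s (hasDerivAt_neg s)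
    have h3 := (hs.add this).sub_const (2 * h 0)
    refine h3.congr_deriv ?_
    simp [sub_eq_add_neg]
  · filter_upwards with s
    simpa using hasDerivAt_pow 2 s
  · filter_upwards [self_mem_nhdsWithin] with s hs
    have : (0 : ℝ) < s := hs
    positivity
  · have hc : ContinuousAt h 0 := h1.self_of_nhds.continuousAt
    have hc' : Tendsto (fun s => h (-s)) (nhds 0) (nhds (h 0)) := hc.tendsto.comp hneg
    have h3 : Tendsto (fun s => h s + h (-s) - 2 * h 0) (nhds 0) (nhds (h 0 + h 0 - 2 * h 0)) :=
      (hc.tendsto.add hc').sub_const _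
    rw [show h 0 + h 0 - 2 * h 0 = 0 by ring] at h3
    exact h3.mono_left nhdsWithin_le_nhds
  · have h3 : Tendsto (fun s : ℝ => s ^ 2) (nhds 0) (nhds 0) := by
      simpa using (continuous_pow (M := ℝ) 2).tendsto 0
    exact h3.mono_left nhdsWithin_le_nhds
  · have h2n : HasDerivAt (fun s => h' (-s)) (-c) 0 := by
      have h2' : HasDerivAt h' c (-0) := by simpa using h2
      have := h2'.scomp (0 : ℝ) (hasDerivAt_neg (0 : ℝ))
      exact this.congr_deriv (by simp)
    have h3 := (h2.sub h2n)
    have h4 := (hasDerivAt_iff_tendsto_slope.1 h3)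
    have h5 := h4.mono_left (nhdsWithin_mono (0 : ℝ) (fun s (hs : s ∈ Ioi (0 : ℝ)) => (ne_of_gt hs : s ≠ 0)))
    have h6 := h5.div_const 2
    rw [show (c - -c) / 2 = c by ring] at h6
    refine h6.congr' ?_
    filter_upwards [self_mem_nhdsWithin] with s hs
    have hs : (0 : ℝ) < s := hs
    simp only [slope_def_field, Pi.sub_apply, neg_zero, sub_self, sub_zero]
    field_simp

lemma SymD2.sub {f g : ℝ → ℝ} {c d : ℝ} (hf : SymD2 f c) (hg : SymD2 g d) :
    SymD2 (fun s => f s - g s) (c - d) := by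
  unfold SymD2 at *
  refine (Tendsto.sub hf hg).congr (fun s => ?_)
  ring

lemma SymD2.const_mul {f : ℝ → ℝ} {c : ℝ} (k : ℝ) (hf : SymD2 f c) :
    SymD2 (fun s => k * f s) (k * c) := by
  unfold SymD2 at *
  refine (Tendsto.const_mul k hf).congr (fun s => ?_)
  ring

lemma SymD2.sum {ι : Type*} (S : Finset ι) {f : ι → ℝ → ℝ} {c : ι → ℝ}
    (hf : ∀ i ∈ S, SymD2 (f i) (c i)) :
    SymD2 (fun s => ∑ i ∈ S, f i s) (∑ i ∈ S, c i) := by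
  unfold SymD2 at *
  refine (tendsto_finsetSum S hf).congr (fun s => ?_)
  rw [← Finset.sum_div, Finset.sum_sub_distrib, Finset.sum_add_distrib, Finset.mul_sum]

lemma SymD2.nonpos {h : ℝ → ℝ} {c : ℝ} (hh : SymD2 h c)
    (hm : ∀ᶠ s in nhds (0 : ℝ), h s ≤ h 0) : c ≤ 0 := by
  have hneg : Tendsto (fun s : ℝ => -s) (nhds 0) (nhds 0) := by
    simpa using (continuous_neg (G := ℝ)).tendsto 0
  refine le_of_tendsto hh ?_
  apply Filter.Eventually.filter_mono nhdsWithin_le_nhds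
  filter_upwards [hm, hneg.eventually hm] with s h1 h2
  apply div_nonpos_of_nonpos_of_nonneg _ (sq_nonneg s)
  linarith

/-- A function which is maximal at `t` from the left has nonnegative derivative there. -/
lemma deriv_nonneg_of_left_max {h : ℝ → ℝ} {c t : ℝ} (hh : HasDerivAt h c t)
    (hm : ∀ᶠ s in nhdsWithin t (Iio t), h s ≤ h t) : 0 ≤ c := by
  have h4 := (hasDerivAt_iff_tendsto_slope.1 hh)
  have h5 := h4.mono_left (nhdsWithin_mono t (fun s (hs : s ∈ Iio t) => (ne_of_lt hs : s ≠ t)))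
  refine ge_of_tendsto h5 ?_
  filter_upwards [hm, self_mem_nhdsWithin] with s h1 hs
  have hs : s < t := hs
  rw [slope_def_field]
  exact div_nonneg_of_nonpos (by linarith) (by linarith)

/-- The Hessian quadratic form. -/
def qf {d : ℕ} (v : EuclideanSpace ℝ (Fin d) → ℝ) (x b : EuclideanSpace ℝ (Fin d)) : ℝ :=
  ∑ i, ∑ j, b i * b j * sd2 i j v x

lemma sd2_eq {d : ℕ} {v : EuclideanSpace ℝ (Fin d) → ℝ} {x : EuclideanSpace ℝ (Fin d)}
    (hv : ContDiffAt ℝ 2 v x) (i j : Fin d) :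
    sd2 i j v x = fderiv ℝ (fderiv ℝ v) x (EuclideanSpace.single i 1)
      (EuclideanSpace.single j 1) := by
  have h1 : DifferentiableAt ℝ (fderiv ℝ v) x :=
    (hv.fderiv_right (m := 1) (by norm_num)).differentiableAt (by norm_num)
  unfold sd2 sd
  have := (h1.hasFDerivAt.clm_apply (hasFDerivAt_const (EuclideanSpace.single j (1 : ℝ)) x)).fderiv
  rw [this]
  simp

lemma qf_eq {d : ℕ} {v : EuclideanSpace ℝ (Fin d) → ℝ} {x : EuclideanSpace ℝ (Fin d)}
    (hv : ContDiffAt ℝ 2 v x) (b : EuclideanSpace ℝ (Fin d)) :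
    qf v x b = fderiv ℝ (fderiv ℝ v) x b b := by
  have hb : b = ∑ i, b i • EuclideanSpace.single i (1 : ℝ) := by
    ext k
    simp [Finset.sum_apply, Pi.single_apply]
  unfold qf
  conv_rhs => rw [hb]
  simp only [map_sum, map_smul, sum_apply, smul_apply,
    smul_eq_mul, sd2_eq hv]
  rw [Finset.sum_comm]
  simp only [Finset.mul_sum]
  refine Finset.sum_congr rfl fun i _ => Finset.sum_congr rfl fun j _ => ?_
  ring

lemma sd2_polar {d : ℕ} {v : EuclideanSpace ℝ (Fin d) → ℝ} {x : EuclideanSpace ℝ (Fin d)}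
    (hv : ContDiffAt ℝ 2 v x) (i j : Fin d) :
    sd2 i j v x =
      qf v x ((1 / 2 : ℝ) • (EuclideanSpace.single i 1 + EuclideanSpace.single j 1)) -
      qf v x ((1 / 2 : ℝ) • (EuclideanSpace.single i 1 - EuclideanSpace.single j 1)) := by
  have hs := hv.isSymmSndFDerivAt (by simp)
  have := hs (EuclideanSpace.single i (1 : ℝ)) (EuclideanSpace.single j 1)
  rw [qf_eq hv, qf_eq hv, sd2_eq hv]
  simp only [map_smul, map_add, map_sub, add_apply,
    sub_apply, smul_apply, smul_eq_mul]
  linarith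

lemma symD2_line {d : ℕ} {v : EuclideanSpace ℝ (Fin d) → ℝ} {x : EuclideanSpace ℝ (Fin d)}
    (hv : ContDiffAt ℝ 2 v x) (b : EuclideanSpace ℝ (Fin d)) :
    SymD2 (fun τ => v (x + τ • b)) (qf v x b) := by
  have hl : ∀ τ : ℝ, HasDerivAt (fun τ : ℝ => x + τ • b) b τ := fun τ => by
    simpa using ((hasDerivAt_id τ).smul_const b).const_add x
  have hl0 : Tendsto (fun τ : ℝ => x + τ • b) (nhds 0) (nhds x) := by
    simpa using (hl 0).continuousAt.tendsto
  have h1 : DifferentiableAt ℝ (fderiv ℝ v) x :=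
    (hv.fderiv_right (m := 1) (by norm_num)).differentiableAt (by norm_num)
  rw [qf_eq hv]
  apply symD2_of_deriv (h' := fun τ => fderiv ℝ v (x + τ • b) b)
  · have := hl0.eventually (hv.eventually (by simp))
    filter_upwards [this] with τ hτ
    exact (hτ.differentiableAt (by norm_num)).hasFDerivAt.comp_hasDerivAt τ (hl τ)
  · have h1' : HasFDerivAt (fderiv ℝ v) (fderiv ℝ (fderiv ℝ v) x) (x + (0 : ℝ) • b) := by
      simpa using h1.hasFDerivAt
    have h2 := h1'.comp_hasDerivAt (0 : ℝ) (hl 0)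
    have h3 := h2.clm_apply (hasDerivAt_const (0 : ℝ) b)
    simpa using h3

/-- Constant symmetric elliptic matrices. -/
def EllM (d : ℕ) (ν : ℝ) (A : Fin d → Fin d → ℝ) : Prop :=
  (∀ i j, A i j = A j i) ∧ ∀ ξ : Fin d → ℝ,
    ν * ∑ i, ξ i ^ 2 ≤ ∑ i, ∑ j, A i j * ξ i * ξ j ∧
      ∑ i, ∑ j, A i j * ξ i * ξ j ≤ ν⁻¹ * ∑ i, ξ i ^ 2

lemma EllM.diag {d : ℕ} {ν : ℝ} {A : Fin d → Fin d → ℝ} (h : EllM d ν A) (i : Fin d) :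
    A i i ≤ ν⁻¹ := by
  have := (h.2 (Pi.single i 1)).2
  simpa [Pi.single_apply] using this

lemma EllM.bound {d : ℕ} {ν : ℝ} (hν : 0 < ν) {A : Fin d → Fin d → ℝ} (h : EllM d ν A)
    (i j : Fin d) : |A i j| ≤ ν⁻¹ := by
  have hi := h.diag i
  have hj := h.diag j
  have h1 := (h.2 (Pi.single i 1 + Pi.single j 1)).1
  have h2 := (h.2 (Pi.single i 1 - Pi.single j 1)).1
  have p1 : 0 ≤ ∑ k, (Pi.single i 1 + Pi.single j 1 : Fin d → ℝ) k ^ 2 :=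
    Finset.sum_nonneg fun _ _ => sq_nonneg _
  have p2 : 0 ≤ ∑ k, (Pi.single i 1 - Pi.single j 1 : Fin d → ℝ) k ^ 2 :=
    Finset.sum_nonneg fun _ _ => sq_nonneg _
  have e1 : ∑ k, ∑ l, A k l * (Pi.single i 1 + Pi.single j 1 : Fin d → ℝ) k *
      (Pi.single i 1 + Pi.single j 1 : Fin d → ℝ) l = A i i + A i j + A j i + A j j := by
    simp [Pi.single_apply, mul_add, Finset.sum_add_distrib]
    ring
  have e2 : ∑ k, ∑ l, A k l * (Pi.single i 1 - Pi.single j 1 : Fin d → ℝ) k *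
      (Pi.single i 1 - Pi.single j 1 : Fin d → ℝ) l = A i i - A i j - A j i + A j j := by
    simp [Pi.single_apply, mul_sub, Finset.sum_sub_distrib]
    ring
  rw [e1] at h1
  rw [e2] at h2
  have hs := h.1 i j
  rw [abs_le]
  constructor <;> nlinarith [mul_nonneg hν.le p1, mul_nonneg hν.le p2]

lemma isCompact_EllM (d : ℕ) {ν : ℝ} (hν : 0 < ν) : IsCompact {A | EllM d ν A} := by
  have hb : {A | EllM d ν A} ⊆ Set.pi univ fun _ => Set.pi univ fun _ => Icc (-ν⁻¹) ν⁻¹ := by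
    intro A hA i _ j _
    exact abs_le.1 (EllM.bound hν hA i j)
  have hc : IsCompact (Set.pi univ fun _ : Fin d => Set.pi univ fun _ : Fin d => Icc (-ν⁻¹) ν⁻¹) :=
    isCompact_univ_pi fun _ => isCompact_univ_pi fun _ => isCompact_Icc
  refine hc.of_isClosed_subset ?_ hb
  have : {A | EllM d ν A} = (⋂ i, ⋂ j, {A : Fin d → Fin d → ℝ | A i j = A j i}) ∩
      ⋂ ξ : Fin d → ℝ, ({A : Fin d → Fin d → ℝ | ν * ∑ i, ξ i ^ 2 ≤ ∑ i, ∑ j, A i j * ξ i * ξ j} ∩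
        {A : Fin d → Fin d → ℝ | ∑ i, ∑ j, A i j * ξ i * ξ j ≤ ν⁻¹ * ∑ i, ξ i ^ 2}) := by
    ext A
    simp [EllM]
  rw [this]
  refine IsClosed.inter ?_ ?_
  · exact isClosed_iInter fun i => isClosed_iInter fun j =>
      isClosed_eq (by fun_prop) (by fun_prop)
  · exact isClosed_iInter fun ξ => IsClosed.inter
      (isClosed_le (by fun_prop) (by fun_prop)) (isClosed_le (by fun_prop) (by fun_prop))

lemma isOpen_parQ (d : ℕ) (ρ : ℝ) : IsOpen (parQ d ρ) := isOpen_Ioo.prod isOpen_ball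

/-- The operator with frozen coefficients. -/
def frz {d : ℕ} (A : Fin d → Fin d → ℝ) (u : ℝ → EuclideanSpace ℝ (Fin d) → ℝ) (t : ℝ)
    (x : EuclideanSpace ℝ (Fin d)) : ℝ :=
  td u t x - ∑ i, ∑ j, A i j * sd2 i j (u t) x

lemma freeze {d q : ℕ} {ν δ K : ℝ} (hν : 0 < ν)
    {a : Fin d → Fin d → ℝ → EuclideanSpace ℝ (Fin d) → ℝ}
    {u f : ℝ → EuclideanSpace ℝ (Fin d) → ℝ}
    (hsym : ∀ i j t x, a i j t x = a j i t x)
    (hell : UnifEllipticP d ν a)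
    (hind : ∀ i j (t : ℝ) (x y : EuclideanSpace ℝ (Fin d)),
          (∀ k : Fin d, q ≤ (k : ℕ) → x k = y k) → a i j t x = a i j t y)
    (hu : ParClassical (parQ d 1) u)
    (heq : ∀ᵐ z ∂(volume.restrict (parQ d 1)),
          td u z.1 z.2 - ∑ i, ∑ j, a i j z.1 z.2 * sd2 i j (u z.1) z.2 = f z.1 z.2)
    (hf : PHolderXPar d q δ (parQ d 1) f K)
    (t : ℝ) (x : EuclideanSpace ℝ (Fin d)) (H : Finset (EuclideanSpace ℝ (Fin d)))
    (hH : ∀ h ∈ H, ∀ k : Fin d, q ≤ (k : ℕ) → h k = 0)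
    (hHQ : ∀ h ∈ H, (t, x + h) ∈ parQ d 1) :
    ∃ A, EllM d ν A ∧ ∀ h ∈ H, ∀ h' ∈ H,
      |frz A u t (x + h) - frz A u t (x + h')| ≤ K * dist h h' ^ δ := by
  obtain ⟨-, -, -, htd, -, hD2⟩ := hu
  have hQ := isOpen_parQ d 1
  have : (volume : Measure (ℝ × EuclideanSpace ℝ (Fin d))).IsAddHaarMeasure := by
    rw [Measure.volume_eq_prod]
    infer_instance
  rw [ae_restrict_iff' hQ.measurableSet] at heq
  -- the equation holds at all shifted points, for almost every base point
  have h1 : ∀ᵐ z : ℝ × EuclideanSpace ℝ (Fin d), ∀ h ∈ H,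
      ((z.1, z.2 + h) ∈ parQ d 1 → frz (fun i j => a i j z.1 (z.2 + h)) u z.1 (z.2 + h)
        = f z.1 (z.2 + h)) := by
    rw [Filter.eventually_all_finset]
    intro h _
    have := (measurePreserving_add_right (volume : Measure (ℝ × EuclideanSpace ℝ (Fin d)))
      ((0 : ℝ), h)).quasiMeasurePreserving.ae heq
    filter_upwards [this] with z hz
    have e : z + ((0 : ℝ), h) = (z.1, z.2 + h) := by
      ext <;> simp
    rw [e] at hz
    exact hz
  have hdense := Measure.dense_of_ae h1
  have hnb : ∀ᶠ z : ℝ × EuclideanSpace ℝ (Fin d) in nhds (t, x), ∀ h ∈ H,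
      (z.1, z.2 + h) ∈ parQ d 1 := by
    rw [Filter.eventually_all_finset]
    intro h hh
    have hc : Continuous fun z : ℝ × EuclideanSpace ℝ (Fin d) => (z.1, z.2 + h) := by fun_prop
    exact hc.continuousAt.eventually (hQ.mem_nhds (hHQ h hh))
  obtain ⟨z, hz, hzlim⟩ := mem_closure_iff_seq_limit.1 (hdense (t, x))
  obtain ⟨A, hA, φ, hφ, hAlim⟩ := (isCompact_EllM d hν).tendsto_subseq
    (x := fun n => fun i j => a i j (z n).1 (z n).2)
    (fun n => ⟨fun i j => hsym i j _ _, fun ξ => hell _ _ ξ⟩)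
  have hzφ := hzlim.comp hφ.tendsto_atTop
  refine ⟨A, hA, fun h hh h' hh' => ?_⟩
  have key : ∀ h ∈ H, Tendsto (fun n => frz (fun i j => a i j (z (φ n)).1 (z (φ n)).2) u
      (z (φ n)).1 ((z (φ n)).2 + h)) atTop (nhds (frz A u t (x + h))) := by
    intro h hh
    have hc : Continuous fun z : ℝ × EuclideanSpace ℝ (Fin d) => (z.1, z.2 + h) := by fun_prop
    have hl : Tendsto (fun n => ((z (φ n)).1, (z (φ n)).2 + h)) atTop (nhds (t, x + h)) :=
      (hc.tendsto (t, x)).comp hzφ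
    have hmem := hQ.mem_nhds (hHQ h hh)
    unfold frz
    refine Tendsto.sub ((htd.continuousAt hmem).tendsto.comp hl) ?_
    refine tendsto_finsetSum _ fun i _ => tendsto_finsetSum _ fun j _ => ?_
    refine Tendsto.mul ?_ (((hD2 i j).continuousAt hmem).tendsto.comp hl)
    exact (tendsto_pi_nhds.1 (tendsto_pi_nhds.1 hAlim i) j)
  refine le_of_tendsto ((key h hh).sub (key h' hh')).abs ?_
  filter_upwards [hzφ.eventually hnb] with n hn
  have e : ∀ h ∈ H, frz (fun i j => a i j (z (φ n)).1 (z (φ n)).2) u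
      (z (φ n)).1 ((z (φ n)).2 + h) = f (z (φ n)).1 ((z (φ n)).2 + h) := by
    intro h hh
    rw [← hz (φ n) h hh (hn h hh)]
    congr 1
    funext i j
    apply hind
    intro k hk
    simp [hH h hh k hk]
  rw [e h hh, e h' hh']
  have := hf (z (φ n)).1 _ _ (hn h hh) (hn h' hh') (by
    intro k hk
    simp [hH h hh k hk, hH h' hh' k hk])
  simpa [dist_add_left] using this

open scoped MatrixOrder ComplexOrder in
/-- Splitting off the directions `e j` and writing the rest as a sum of squares. -/
lemma EllM.decomp {d : ℕ} {ν : ℝ} (hν : 0 < ν) {A : Fin d → Fin d → ℝ} (h : EllM d ν A)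
    (e : Fin 3 → EuclideanSpace ℝ (Fin d)) (he : ∀ k, ‖e k‖ ≤ 1) :
    ∃ v : Fin d → EuclideanSpace ℝ (Fin d),
      (∀ i j, A i j = ∑ k, v k i * v k j + (ν / 3) * ∑ k, e k i * e k j) ∧
      ∑ k, ‖v k‖ ^ 2 ≤ d * ν⁻¹ := by
  let A' : Matrix (Fin d) (Fin d) ℝ := Matrix.of fun i j => A i j - (ν / 3) * ∑ k, e k i * e k j
  have hps : A'.PosSemidef := by
    refine Matrix.PosSemidef.of_dotProduct_mulVec_nonneg ?_ ?_
    · ext i j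
      simp only [A', Matrix.conjTranspose_apply, Matrix.of_apply, star_trivial]
      rw [h.1 j i]
      congr 2
      exact Finset.sum_congr rfl fun k _ => mul_comm _ _
    · intro ξ
      have h1 := (h.2 ξ).1
      have h2 : ∀ k, (∑ i, e k i * ξ i) ^ 2 ≤ ∑ i, ξ i ^ 2 := by
        intro k
        have hcs := Finset.sum_mul_sq_le_sq_mul_sq Finset.univ (fun i => e k i) ξ
        have hn : ∑ i, e k i ^ 2 ≤ 1 := by
          have := EuclideanSpace.real_norm_sq_eq (e k)
          rw [← this]
          nlinarith [he k, norm_nonneg (e k)]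
        have hp : 0 ≤ ∑ i, ξ i ^ 2 := Finset.sum_nonneg fun _ _ => sq_nonneg _
        nlinarith
      have h3 : star ξ ⬝ᵥ A'.mulVec ξ = ∑ i, ∑ j, A i j * ξ i * ξ j -
          (ν / 3) * ∑ k, (∑ i, e k i * ξ i) ^ 2 := by
        have h4 : ∑ k, (∑ i, e k i * ξ i) ^ 2 =
            ∑ i, ∑ j, ξ i * ((∑ k, e k i * e k j) * ξ j) := by
          simp only [sq, Finset.sum_mul, Finset.mul_sum]
          rw [Finset.sum_comm]
          refine Finset.sum_congr rfl fun i _ => ?_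
          rw [Finset.sum_comm]
          refine Finset.sum_congr rfl fun j _ => Finset.sum_congr rfl fun k _ => ?_
          ring
        rw [h4]
        simp only [dotProduct, Matrix.mulVec, A', Matrix.of_apply, Pi.star_apply, star_trivial]
        simp only [Finset.mul_sum (a := ν / 3), ← Finset.sum_sub_distrib]
        refine Finset.sum_congr rfl fun i _ => ?_
        rw [Finset.mul_sum]
        refine Finset.sum_congr rfl fun j _ => ?_
        simp only [← Finset.mul_sum]
        ring
      rw [h3, Fin.sum_univ_three]
      nlinarith [h2 0, h2 1, h2 2]
  obtain ⟨B, hB⟩ := (CStarAlgebra.nonneg_iff_eq_star_mul_self (a := A')).1 hps.nonneg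
  have hA' : ∀ i j, A' i j = ∑ k, B k i * B k j := by
    intro i j
    rw [hB]
    simp [Matrix.mul_apply, Matrix.star_apply]
  refine ⟨fun k => WithLp.toLp 2 (B k), fun i j => ?_, ?_⟩
  · have := hA' i j
    simp only [A', Matrix.of_apply] at this
    simp only
    linarith
  · have h5 : ∀ k, ‖(WithLp.toLp 2 (B k) : EuclideanSpace ℝ (Fin d))‖ ^ 2 = ∑ i, B k i * B k i := by
      intro k
      rw [EuclideanSpace.real_norm_sq_eq]
      simp [sq]
    simp only [h5]
    rw [Finset.sum_comm]
    calc ∑ i, ∑ k, B k i * B k i = ∑ i, A' i i :=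
          Finset.sum_congr rfl fun i _ => (hA' i i).symm
      _ ≤ ∑ i : Fin d, ν⁻¹ := by
          refine Finset.sum_le_sum fun i _ => ?_
          have h6 := h.diag i
          have h7 : 0 ≤ ∑ k, e k i * e k i := Finset.sum_nonneg fun _ _ => mul_self_nonneg _
          simp only [A', Matrix.of_apply]
          nlinarith
      _ = d * ν⁻¹ := by simp

lemma SymD2.congr {f g : ℝ → ℝ} {c : ℝ} (hf : SymD2 f c)
    (h : ∀ᶠ s in nhds (0 : ℝ), f s = g s) : SymD2 g c := by
  have hneg : Tendsto (fun s : ℝ => -s) (nhds 0) (nhds 0) := by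
    simpa using (continuous_neg (G := ℝ)).tendsto 0
  refine Tendsto.congr' ?_ hf
  apply Filter.Eventually.filter_mono nhdsWithin_le_nhds
  filter_upwards [h, hneg.eventually h] with s h1 h2
  rw [h1, h2, h.self_of_nhds]

lemma bar_aux (b p r : Fin 3 → ℝ) (hb : ∀ k, 0 < b k) (α : ℝ) :
    (∀ᶠ τ in nhds (0 : ℝ), ∀ k, 0 < b k + p k * τ + r k * τ ^ 2) ∧
    (∀ᶠ τ in nhds (0 : ℝ), Real.exp (α * ∑ k, Real.log (b k + p k * τ + r k * τ ^ 2)) =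
      (∏ k, (b k + p k * τ + r k * τ ^ 2)) ^ α) ∧
    (∀ᶠ τ in nhds (0 : ℝ), HasDerivAt
      (fun τ => Real.exp (α * ∑ k, Real.log (b k + p k * τ + r k * τ ^ 2)))
      (Real.exp (α * ∑ k, Real.log (b k + p k * τ + r k * τ ^ 2)) *
        (α * ∑ k, (p k + 2 * r k * τ) / (b k + p k * τ + r k * τ ^ 2))) τ) := by
  have h0 : ∀ᶠ τ in nhds (0 : ℝ), ∀ k, 0 < b k + p k * τ + r k * τ ^ 2 := by
    rw [Filter.eventually_all]
    intro k
    have hc : Continuous fun τ : ℝ => b k + p k * τ + r k * τ ^ 2 := by fun_prop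
    have := hc.tendsto 0
    exact this.eventually (lt_mem_nhds (by simpa using hb k))
  refine ⟨h0, ?_, ?_⟩
  · filter_upwards [h0] with τ hτ
    rw [Real.rpow_def_of_pos (Finset.prod_pos fun k _ => hτ k),
      Real.log_prod (fun k _ => (hτ k).ne'), mul_comm]
  · filter_upwards [h0] with τ hτ
    apply HasDerivAt.exp
    apply HasDerivAt.const_mul
    have : ∀ k ∈ (Finset.univ : Finset (Fin 3)),
        HasDerivAt (fun τ : ℝ => Real.log (b k + p k * τ + r k * τ ^ 2))
        ((p k + 2 * r k * τ) / (b k + p k * τ + r k * τ ^ 2)) τ := by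
      intro k _
      have hq : HasDerivAt (fun τ : ℝ => b k + p k * τ + r k * τ ^ 2) (p k + 2 * r k * τ) τ := by
        have := (((hasDerivAt_id τ).const_mul (p k)).const_add (b k)).add
          ((hasDerivAt_pow 2 τ).const_mul (r k))
        refine this.congr_deriv ?_
        simp
        ring
      exact hq.log (hτ k).ne'
    exact HasDerivAt.fun_sum this

lemma bar_deriv (b p r : Fin 3 → ℝ) (hb : ∀ k, 0 < b k) (α : ℝ) :
    HasDerivAt (fun τ : ℝ => (∏ k, (b k + p k * τ + r k * τ ^ 2)) ^ α)
      (α * (∏ k, b k) ^ α * ∑ k, p k / b k) 0 := by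
  obtain ⟨h0, h1, h2⟩ := bar_aux b p r hb α
  have h3 := h2.self_of_nhds.congr_of_eventuallyEq (h1.mono fun τ h => h.symm)
  refine h3.congr_deriv ?_
  rw [h1.self_of_nhds]
  simp
  ring

lemma bar_symD2 (b p r : Fin 3 → ℝ) (hb : ∀ k, 0 < b k) (α : ℝ) :
    SymD2 (fun τ : ℝ => (∏ k, (b k + p k * τ + r k * τ ^ 2)) ^ α)
      (α * (∏ k, b k) ^ α *
        (∑ k, 2 * r k / b k - ∑ k, (p k / b k) ^ 2 + α * (∑ k, p k / b k) ^ 2)) := by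
  obtain ⟨h0, h1, h2⟩ := bar_aux b p r hb α
  refine SymD2.congr (symD2_of_deriv h2 ?_) h1
  have h4 : HasDerivAt (fun τ : ℝ =>
      α * ∑ k, (p k + 2 * r k * τ) / (b k + p k * τ + r k * τ ^ 2))
      (α * ∑ k, (2 * r k / b k - (p k / b k) ^ 2)) 0 := by
    apply HasDerivAt.const_mul
    apply HasDerivAt.fun_sum
    intro k _
    have hn : HasDerivAt (fun τ : ℝ => p k + 2 * r k * τ) (2 * r k) 0 := by
      simpa using ((hasDerivAt_id (0 : ℝ)).const_mul (2 * r k)).const_add (p k)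
    have hd : HasDerivAt (fun τ : ℝ => b k + p k * τ + r k * τ ^ 2) (p k) 0 := by
      have := (((hasDerivAt_id (0 : ℝ)).const_mul (p k)).const_add (b k)).add
        ((hasDerivAt_pow 2 (0 : ℝ)).const_mul (r k))
      refine this.congr_deriv ?_
      simp
    have hbk := hb k
    refine (hn.div hd (by simpa using hbk.ne')).congr_deriv ?_
    simp
    field_simp
  have h5 := h2.self_of_nhds.mul h4
  refine h5.congr_deriv ?_
  rw [h1.self_of_nhds, Finset.sum_sub_distrib]
  simp
  ring

lemma bar_x (b : Fin 3 → ℝ) (m w p α : ℝ) (hb : ∀ k, 0 < b k) (hm : ∀ k, m ≤ b k)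
    (hw : 0 ≤ w) (hp : p ^ 2 ≤ 4 * w * m) (hα : α < 1) :
    ∑ k, 2 * w / b k - ∑ k, (p / b k) ^ 2 + α * (∑ k, p / b k) ^ 2 ≤
      10 * w * ∑ k, 1 / b k := by
  have h1 : ∀ k, (p / b k) ^ 2 ≤ 4 * w * (1 / b k) := by
    intro k
    have hbk := hb k
    rw [div_pow, div_le_iff₀ (by positivity)]
    have : 4 * w * (1 / b k) * b k ^ 2 = 4 * w * b k := by field_simp
    rw [this]
    nlinarith [hm k]
  have h2 : (∑ k, p / b k) ^ 2 ≤ 3 * ∑ k, (p / b k) ^ 2 := by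
    simpa using sq_sum_le_card_mul_sum_sq (s := Finset.univ) (f := fun k : Fin 3 => p / b k)
  have h3 : ∑ k, (p / b k) ^ 2 ≤ ∑ k, 4 * w * (1 / b k) := Finset.sum_le_sum fun k _ => h1 k
  rw [← Finset.mul_sum] at h3
  have h4 : ∑ k, 2 * w / b k = 2 * w * ∑ k, 1 / b k := by
    rw [Finset.mul_sum]
    exact Finset.sum_congr rfl fun k _ => by ring
  have h5 : α * (∑ k, p / b k) ^ 2 ≤ (∑ k, p / b k) ^ 2 := by
    nlinarith [sq_nonneg (∑ k, p / b k)]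
  rw [h4]
  nlinarith

lemma bar_s (b : Fin 3 → ℝ) (j : Fin 3) (m D s α : ℝ) (hb : ∀ k, 0 < b k) (hm : ∀ k, m ≤ b k)
    (hs0 : 0 ≤ s) (hs : s ≤ 1 / 16) (hsm : s ^ 2 ≤ m) (hD : 0 ≤ D)
    (hα0 : 0 < α) (hα : α < 1) :
    ∑ k, 2 * (1 - if k = j then D else 0) / b k -
      ∑ k, ((2 * s + if k = j then D * (1 - 2 * s) else 0) / b k) ^ 2 +
      α * (∑ k, (2 * s + if k = j then D * (1 - 2 * s) else 0) / b k) ^ 2 ≤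
      (2 + 24 / (1 - α)) * ∑ k, 1 / b k - 2 * D * (1 / b j) -
        (1 - α) / 2 * (D * (1 - 2 * s) / b j) ^ 2 := by
  set P := D * (1 - 2 * s) / b j with hP
  set Y := ∑ k, 1 / b k with hY
  have hP0 : 0 ≤ P := div_nonneg (mul_nonneg hD (by linarith)) (hb j).le
  have e1 : ∑ k, 2 * (1 - if k = j then D else 0) / b k = 2 * Y - 2 * D * (1 / b j) := by
    have : ∀ k, 2 * (1 - if k = j then D else 0) / b k =
        2 * (1 / b k) - if k = j then 2 * D * (1 / b k) else 0 := by
      intro k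
      split_ifs <;> ring
    simp only [this, Finset.sum_sub_distrib, ← Finset.mul_sum, Finset.sum_ite_eq', Finset.mem_univ,
      if_true, hY]
  have e2 : ∑ k, (2 * s + if k = j then D * (1 - 2 * s) else 0) / b k =
      2 * s * Y + P := by
    have : ∀ k, (2 * s + if k = j then D * (1 - 2 * s) else 0) / b k =
        2 * s * (1 / b k) + if k = j then D * (1 - 2 * s) / b k else 0 := by
      intro k
      split_ifs <;> ring
    simp only [this, Finset.sum_add_distrib, ← Finset.mul_sum, Finset.sum_ite_eq', Finset.mem_univ,
      if_true, hY, hP]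
  have e3 : P ^ 2 ≤ ∑ k, ((2 * s + if k = j then D * (1 - 2 * s) else 0) / b k) ^ 2 := by
    refine le_trans ?_ (Finset.single_le_sum (f := fun k =>
      ((2 * s + if k = j then D * (1 - 2 * s) else 0) / b k) ^ 2)
      (fun k _ => sq_nonneg _) (Finset.mem_univ j))
    simp only [if_true]
    apply pow_le_pow_left₀ hP0
    rw [hP]
    apply div_le_div_of_nonneg_right _ (hb j).le
    linarith
  have e4 : (2 * s * Y) ^ 2 ≤ 12 * Y := by
    have h2 : Y ^ 2 ≤ 3 * ∑ k, (1 / b k) ^ 2 := by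
      simpa [hY] using sq_sum_le_card_mul_sum_sq (s := Finset.univ) (f := fun k : Fin 3 => 1 / b k)
    have h1 : ∀ k, s ^ 2 * (1 / b k) ^ 2 ≤ 1 / b k := by
      intro k
      have hbk := hb k
      have : s ^ 2 * (1 / b k) ^ 2 = (s ^ 2 / b k) * (1 / b k) := by ring
      rw [this]
      have h3 : s ^ 2 / b k ≤ 1 := by
        rw [div_le_one hbk]
        linarith [hm k]
      have h4 : 0 ≤ 1 / b k := by positivity
      nlinarith
    have h3 : s ^ 2 * ∑ k, (1 / b k) ^ 2 ≤ Y := by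
      rw [Finset.mul_sum]
      exact Finset.sum_le_sum fun k _ => h1 k
    nlinarith [sq_nonneg s]
  set Z := 2 * s * Y with hZ
  have h1α : 0 < 1 - α := by linarith
  have e5 : α * (Z + P) ^ 2 ≤ (1 + α) / 2 * P ^ 2 + 2 / (1 - α) * Z ^ 2 := by
    rw [show (1 + α) / 2 * P ^ 2 + 2 / (1 - α) * Z ^ 2 =
      ((1 + α) * (1 - α) * P ^ 2 + 4 * Z ^ 2) / (2 * (1 - α)) by field_simp; ring]
    rw [le_div_iff₀ (by positivity)]
    nlinarith [sq_nonneg ((1 - α) * P - 2 * α * Z), sq_nonneg Z, sq_nonneg P,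
      mul_nonneg h1α.le (sq_nonneg Z), mul_nonneg hα0.le (sq_nonneg Z),
      mul_nonneg (mul_nonneg hα0.le h1α.le) (sq_nonneg Z),
      sq_nonneg (1 - α), mul_nonneg (sq_nonneg α) (sq_nonneg Z)]
  have e6 : 2 / (1 - α) * Z ^ 2 ≤ 24 / (1 - α) * Y := by
    have : 24 / (1 - α) * Y = 2 / (1 - α) * (12 * Y) := by ring
    rw [this]
    exact mul_le_mul_of_nonneg_left e4 (by positivity)
  rw [e1, e2]
  nlinarith

/-- the quantity `F Σ 1/b²` dominates `(min b)^δ`. -/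
lemma bar_low (b : Fin 3 → ℝ) (hb : ∀ k, 0 < b k) (δ : ℝ) (hδ : 0 < δ) :
    ∃ j, b j ^ δ ≤ (∏ k, b k) ^ ((2 + δ) / 3) * ∑ k, (1 / b k) ^ 2 := by
  obtain ⟨j, -, hj⟩ := Finset.exists_min_image Finset.univ b ⟨0, Finset.mem_univ _⟩
  refine ⟨j, ?_⟩
  have hbj := hb j
  have h1 : b j ^ 3 ≤ ∏ k, b k := by
    have := Finset.prod_le_prod (s := Finset.univ) (f := fun _ : Fin 3 => b j) (g := b)
      (fun _ _ => hbj.le) (fun k _ => hj k (Finset.mem_univ _))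
    simpa using this
  have h2 : (b j ^ 3) ^ ((2 + δ) / 3) ≤ (∏ k, b k) ^ ((2 + δ) / 3) :=
    Real.rpow_le_rpow (by positivity) h1 (by positivity)
  have h3 : (b j ^ 3) ^ ((2 + δ) / 3) = b j ^ 2 * b j ^ δ := by
    rw [← Real.rpow_natCast, ← Real.rpow_mul hbj.le, ← Real.rpow_natCast (b j) 2,
      ← Real.rpow_add hbj]
    congr 1
    push_cast
    ring
  have h4 : (1 / b j) ^ 2 ≤ ∑ k, (1 / b k) ^ 2 :=
    Finset.single_le_sum (f := fun k => (1 / b k) ^ 2) (fun k _ => sq_nonneg _) (Finset.mem_univ j)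
  calc b j ^ δ = (b j ^ 2 * b j ^ δ) * (1 / b j) ^ 2 := by field_simp
    _ ≤ _ := mul_le_mul (h3 ▸ h2) h4 (sq_nonneg _) (Real.rpow_nonneg
        (Finset.prod_nonneg fun k _ => (hb k).le) _)

/-- Signs. -/
def sg (b : Bool) : ℝ := if b then 1 else -1

lemma sg_sq (b : Bool) : sg b * sg b = 1 := by cases b <;> simp [sg]

lemma abs_sg (b : Bool) : |sg b| = 1 := by cases b <;> simp [sg]

/-- Product of the signs. -/
def wt (ε : Fin 3 → Bool) : ℝ := ∏ j, sg (ε j)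

lemma abs_wt (ε : Fin 3 → Bool) : |wt ε| = 1 := by
  simp [wt, Finset.abs_prod, abs_sg]

/-- Flip the sign number `j`. -/
def flp (j : Fin 3) (ε : Fin 3 → Bool) : Fin 3 → Bool := Function.update ε j (!ε j)

lemma flp_flp (j : Fin 3) : Function.Involutive (flp j) := by
  intro ε
  simp [flp]

lemma wt_flp (j : Fin 3) (ε : Fin 3 → Bool) : wt (flp j ε) = - wt ε := by
  have : ∀ b, sg (!b) = - sg b := by intro b; cases b <;> simp [sg]
  fin_cases j <;> simp [wt, flp, Fin.prod_univ_three, Function.update, this]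

lemma pair_sum (j : Fin 3) (G : (Fin 3 → Bool) → ℝ) :
    2 * ∑ ε, wt ε * G ε = ∑ ε, wt ε * (G ε - G (flp j ε)) := by
  have h : ∑ ε, wt ε * G (flp j ε) = - ∑ ε, wt ε * G ε := by
    rw [← Equiv.sum_comp (flp_flp j).toPerm (fun ε => wt ε * G ε), ← Finset.sum_neg_distrib]
    refine Finset.sum_congr rfl fun ε _ => ?_
    simp [Function.Involutive.coe_toPerm, wt_flp]
  simp only [mul_sub, Finset.sum_sub_distrib, h]
  ring

lemma pair_le (j : Fin 3) (G : (Fin 3 → Bool) → ℝ) (B : ℝ)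
    (hG : ∀ ε, |G ε - G (flp j ε)| ≤ B) : |∑ ε, wt ε * G ε| ≤ 4 * B := by
  have h1 : |∑ ε, wt ε * (G ε - G (flp j ε))| ≤ ∑ _ε : Fin 3 → Bool, B := by
    refine (Finset.abs_sum_le_sum_abs _ _).trans (Finset.sum_le_sum fun ε _ => ?_)
    rw [abs_mul, abs_wt, one_mul]
    exact hG ε
  rw [← pair_sum, abs_mul] at h1
  simp at h1
  linarith

section
variable {d : ℕ}

/-- The shift vectors. -/
def sh (e : Fin 3 → EuclideanSpace ℝ (Fin d)) (s : Fin 3 → ℝ) (ε : Fin 3 → Bool) :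
    EuclideanSpace ℝ (Fin d) := ∑ j, (sg (ε j) * s j) • e j

lemma sh_update (e : Fin 3 → EuclideanSpace ℝ (Fin d)) (s : Fin 3 → ℝ) (ε : Fin 3 → Bool)
    (j : Fin 3) (τ : ℝ) :
    sh e (Function.update s j (s j + τ)) ε = sh e s ε + τ • (sg (ε j) • e j) := by
  fin_cases j <;> simp [sh, Fin.sum_univ_three, Function.update] <;> module

lemma sh_flp (e : Fin 3 → EuclideanSpace ℝ (Fin d)) (s : Fin 3 → ℝ) (ε : Fin 3 → Bool)
    (j : Fin 3) : sh e s ε - sh e s (flp j ε) = (2 * sg (ε j) * s j) • e j := by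
  have : ∀ b, sg (!b) = - sg b := by intro b; cases b <;> simp [sg]
  fin_cases j <;> simp [sh, flp, Fin.sum_univ_three, Function.update, this] <;> module

lemma norm_sh_le {e : Fin 3 → EuclideanSpace ℝ (Fin d)} (he : ∀ k, ‖e k‖ ≤ 1) {s : Fin 3 → ℝ}
    {r : ℝ} (hs : ∀ j, |s j| ≤ r) (ε : Fin 3 → Bool) : ‖sh e s ε‖ ≤ 3 * r := by
  have : ∀ j ∈ Finset.univ, ‖(sg (ε j) * s j) • e j‖ ≤ r := by
    intro j _
    rw [norm_smul, Real.norm_eq_abs, abs_mul, abs_sg, one_mul]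
    have := hs j
    have := he j
    nlinarith [norm_nonneg (e j), abs_nonneg (s j)]
  refine (norm_sum_le_of_le _ this).trans ?_
  simp

/-- Triple symmetric differences. -/
def VV (u : ℝ → EuclideanSpace ℝ (Fin d) → ℝ) (e : Fin 3 → EuclideanSpace ℝ (Fin d)) (t : ℝ)
    (x : EuclideanSpace ℝ (Fin d)) (s : Fin 3 → ℝ) : ℝ :=
  ∑ ε, wt ε * u t (x + sh e s ε)

/-- Building blocks of the barrier. -/
def bb (D t₀ : ℝ) (x₀ : EuclideanSpace ℝ (Fin d)) (t : ℝ) (x : EuclideanSpace ℝ (Fin d))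
    (s : Fin 3 → ℝ) (k : Fin 3) : ℝ :=
  ‖x - x₀‖ ^ 2 + (t₀ - t) + ∑ j, s j ^ 2 + D * (s k * (1 - s k))

lemma bb_time (D t₀ : ℝ) (x₀ : EuclideanSpace ℝ (Fin d)) (t : ℝ) (x : EuclideanSpace ℝ (Fin d))
    (s : Fin 3 → ℝ) (k : Fin 3) (τ : ℝ) :
    bb D t₀ x₀ (t + τ) x s k = bb D t₀ x₀ t x s k + (-1) * τ + 0 * τ ^ 2 := by
  unfold bb
  ring

lemma bb_space (D t₀ : ℝ) (x₀ : EuclideanSpace ℝ (Fin d)) (t : ℝ) (x : EuclideanSpace ℝ (Fin d))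
    (s : Fin 3 → ℝ) (k : Fin 3) (v : EuclideanSpace ℝ (Fin d)) (τ : ℝ) :
    bb D t₀ x₀ t (x + τ • v) s k =
      bb D t₀ x₀ t x s k + (2 * inner ℝ (x - x₀) v) * τ + ‖v‖ ^ 2 * τ ^ 2 := by
  unfold bb
  have : x + τ • v - x₀ = (x - x₀) + τ • v := by abel
  rw [this, norm_add_sq_real, inner_smul_right, norm_smul, mul_pow, Real.norm_eq_abs, sq_abs]
  ring

lemma bb_s (D t₀ : ℝ) (x₀ : EuclideanSpace ℝ (Fin d)) (t : ℝ) (x : EuclideanSpace ℝ (Fin d))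
    (s : Fin 3 → ℝ) (k j : Fin 3) (τ : ℝ) :
    bb D t₀ x₀ t x (Function.update s j (s j + τ)) k =
      bb D t₀ x₀ t x s k + (2 * s j + if k = j then D * (1 - 2 * s j) else 0) * τ +
        (1 - if k = j then D else 0) * τ ^ 2 := by
  unfold bb
  fin_cases j <;> fin_cases k <;> simp [Fin.sum_univ_three, Function.update] <;> ring

lemma frz_decomp {ν : ℝ} {A : Fin d → Fin d → ℝ} {v : Fin d → EuclideanSpace ℝ (Fin d)}
    {e : Fin 3 → EuclideanSpace ℝ (Fin d)}
    (hA : ∀ i j, A i j = ∑ k, v k i * v k j + (ν / 3) * ∑ k, e k i * e k j)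
    (u : ℝ → EuclideanSpace ℝ (Fin d) → ℝ) (t : ℝ) (x : EuclideanSpace ℝ (Fin d)) :
    frz A u t x = td u t x - ∑ k, qf (u t) x (v k) - (ν / 3) * ∑ k, qf (u t) x (e k) := by
  unfold frz qf
  have h1 : ∑ i, ∑ j, A i j * sd2 i j (u t) x =
      ∑ k, (∑ i, ∑ j, v k i * v k j * sd2 i j (u t) x) +
      (ν / 3) * ∑ k, (∑ i, ∑ j, e k i * e k j * sd2 i j (u t) x) := by
    have c1 : ∑ k, (∑ i, ∑ j, v k i * v k j * sd2 i j (u t) x) =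
        ∑ i, ∑ j, (∑ k, v k i * v k j) * sd2 i j (u t) x := by
      rw [Finset.sum_comm]
      refine Finset.sum_congr rfl fun i _ => ?_
      rw [Finset.sum_comm]
      exact Finset.sum_congr rfl fun j _ => by rw [Finset.sum_mul]
    have c2 : ∑ k, (∑ i, ∑ j, e k i * e k j * sd2 i j (u t) x) =
        ∑ i, ∑ j, (∑ k, e k i * e k j) * sd2 i j (u t) x := by
      rw [Finset.sum_comm]
      refine Finset.sum_congr rfl fun i _ => ?_
      rw [Finset.sum_comm]
      exact Finset.sum_congr rfl fun j _ => by rw [Finset.sum_mul]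
    rw [c1, c2, Finset.mul_sum, ← Finset.sum_add_distrib]
    refine Finset.sum_congr rfl fun i _ => ?_
    rw [Finset.mul_sum, ← Finset.sum_add_distrib]
    refine Finset.sum_congr rfl fun j _ => ?_
    rw [hA]
    ring
  rw [h1]
  ring

lemma qf_sg (v : EuclideanSpace ℝ (Fin d) → ℝ) (x b : EuclideanSpace ℝ (Fin d)) (c : Bool) :
    qf v x (sg c • b) = qf v x b := by
  unfold qf
  refine Finset.sum_congr rfl fun i _ => Finset.sum_congr rfl fun j _ => ?_
  have := sg_sq c
  simp only [PiLp.smul_apply, smul_eq_mul]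
  linear_combination (b i * b j * sd2 i j v x) * this

/-- What is known about the solution: classical regularity, frozen equation, sup bound. -/
def Good (d q : ℕ) (ν δ A₀ : ℝ) (u : ℝ → EuclideanSpace ℝ (Fin d) → ℝ) : Prop :=
  ParClassical (parQ d 1) u ∧
  (∀ (t : ℝ) (x : EuclideanSpace ℝ (Fin d)) (H : Finset (EuclideanSpace ℝ (Fin d))),
    (∀ h ∈ H, ∀ k : Fin d, q ≤ (k : ℕ) → h k = 0) →
    (∀ h ∈ H, (t, x + h) ∈ parQ d 1) →
    ∃ A, EllM d ν A ∧ ∀ h ∈ H, ∀ h' ∈ H,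
      |frz A u t (x + h) - frz A u t (x + h')| ≤ A₀ * dist h h' ^ δ) ∧
  (∀ z ∈ parQ d 1, |u z.1 z.2| ≤ A₀)

/-- No interior maximum of `V - barrier`. -/
lemma no_interior_max {q : ℕ} {ν δ A₀ D c : ℝ} (hν : 0 < ν) (hδ0 : 0 < δ) (hδ1 : δ < 1)
    (hA₀ : 0 < A₀) {u : ℝ → EuclideanSpace ℝ (Fin d) → ℝ} (hu : Good d q ν δ A₀ u)
    (hD2 : 2 ≤ D)
    (hD : 1 + 10 * (d * ν⁻¹) ≤ (ν / 3) * (2 * D - 6 - 72 / (1 - (2 + δ) / 3)))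
    (hc0 : 0 < c)
    (hc : 8 < c * ((2 + δ) / 3 * (ν / 3) * ((1 - (2 + δ) / 3) / 2)))
    (e : Fin 3 → EuclideanSpace ℝ (Fin d)) (he : ∀ k, ‖e k‖ ≤ 1)
    (he' : ∀ j, ∀ k : Fin d, q ≤ (k : ℕ) → e j k = 0)
    (t₀ t : ℝ) (x₀ x : EuclideanSpace ℝ (Fin d)) (s : Fin 3 → ℝ) (ht : t ≤ t₀)
    (hs0 : ∀ j, 0 < s j) (hs : ∀ j, s j ≤ 1 / 16)
    (hQ : ∀ ε, (t, x + sh e s ε) ∈ parQ d 1)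
    (mt : ∀ᶠ τ in nhdsWithin (0 : ℝ) (Iio 0),
      VV u e (t + τ) x s - c * A₀ * (∏ k, bb D t₀ x₀ (t + τ) x s k) ^ ((2 + δ) / 3) ≤
      VV u e t x s - c * A₀ * (∏ k, bb D t₀ x₀ t x s k) ^ ((2 + δ) / 3))
    (mx : ∀ v, ∀ᶠ τ in nhds (0 : ℝ),
      VV u e t (x + τ • v) s - c * A₀ * (∏ k, bb D t₀ x₀ t (x + τ • v) s k) ^ ((2 + δ) / 3) ≤
      VV u e t x s - c * A₀ * (∏ k, bb D t₀ x₀ t x s k) ^ ((2 + δ) / 3))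
    (ms : ∀ j, ∀ᶠ τ in nhds (0 : ℝ),
      VV u e t x (Function.update s j (s j + τ)) - c * A₀ *
        (∏ k, bb D t₀ x₀ t x (Function.update s j (s j + τ)) k) ^ ((2 + δ) / 3) ≤
      VV u e t x s - c * A₀ * (∏ k, bb D t₀ x₀ t x s k) ^ ((2 + δ) / 3)) : False := by
  obtain ⟨⟨hdt, hdx, -, -, -, -⟩, hfr, -⟩ := hu
  set α := (2 + δ) / 3 with hα
  have hα0 : 0 < α := by positivity
  have hα1 : α < 1 := by rw [hα]; linarith
  set b := bb D t₀ x₀ t x s with hb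
  set m := ‖x - x₀‖ ^ 2 + (t₀ - t) + ∑ j, s j ^ 2 with hm
  have hbm : ∀ k, b k = m + D * (s k * (1 - s k)) := fun k => rfl
  have hsq : ∀ j, s j ^ 2 ≤ ∑ j, s j ^ 2 := fun j =>
    Finset.single_le_sum (f := fun j => s j ^ 2) (fun _ _ => sq_nonneg _) (Finset.mem_univ j)
  have hsm : ∀ j, s j ^ 2 ≤ m := by
    intro j
    rw [hm]
    have := hsq j
    have := sq_nonneg ‖x - x₀‖
    linarith
  have hxm : ‖x - x₀‖ ^ 2 ≤ m := by
    have := hsq 0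
    have := sq_nonneg (s 0)
    rw [hm]
    linarith
  have hsb : ∀ k, s k ≤ b k := by
    intro k
    have h1 := hs0 k
    have h2 := hs k
    have h3 := hsm k
    rw [hbm k]
    have h4 : s k ≤ 2 * (s k * (1 - s k)) := by nlinarith
    have h5 : 2 * (s k * (1 - s k)) ≤ D * (s k * (1 - s k)) :=
      mul_le_mul_of_nonneg_right hD2 (mul_nonneg h1.le (by linarith))
    nlinarith [sq_nonneg (s k)]
  have hb0 : ∀ k, 0 < b k := fun k => lt_of_lt_of_le (hs0 k) (hsb k)
  have hmb : ∀ k, m ≤ b k := by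
    intro k
    have h1 := hs0 k
    have h2 := hs k
    rw [hbm k]
    have : 0 ≤ D * (s k * (1 - s k)) :=
      mul_nonneg (by linarith) (mul_nonneg h1.le (by linarith))
    linarith
  -- freeze the coefficients
  obtain ⟨A, hA, hAf⟩ := hfr t x (Finset.univ.image (sh e s)) (by
      intro h hh k hk
      obtain ⟨ε, -, rfl⟩ := Finset.mem_image.1 hh
      simp [sh, Finset.sum_apply, he' _ k hk]) (by
      intro h hh
      obtain ⟨ε, -, rfl⟩ := Finset.mem_image.1 hh
      exact hQ ε)
  obtain ⟨v, hv, hvn⟩ := hA.decomp hν e he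
  set F := (∏ k, b k) ^ α with hF
  have hF0 : 0 < F := Real.rpow_pos_of_pos (Finset.prod_pos fun k _ => hb0 k) _
  set Y := ∑ k, 1 / b k with hY
  have hY0 : 0 < Y := Finset.sum_pos (fun k _ => one_div_pos.2 (hb0 k)) ⟨0, Finset.mem_univ _⟩
  -- time
  have I1 : c * A₀ * (α * F * (-Y)) ≤ ∑ ε, wt ε * td u t (x + sh e s ε) := by
    have h1 : HasDerivAt (fun τ => VV u e (t + τ) x s) (∑ ε, wt ε * td u t (x + sh e s ε)) 0 := by
      unfold VV
      apply HasDerivAt.fun_sum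
      intro ε _
      apply HasDerivAt.const_mul
      have h2 := (hdt _ (hQ ε)).hasDerivAt
      simp only at h2
      have h2' : HasDerivAt (fun r => u r (x + sh e s ε))
          (deriv (fun r => u r (x + sh e s ε)) t) (t + 0) := by simpa using h2
      exact h2'.comp_const_add t 0
    have h3 := bar_deriv b (fun _ => -1) (fun _ => 0) hb0 α
    have h4 := h1.sub (h3.const_mul (c * A₀))
    have h5 := deriv_nonneg_of_left_max h4 (by
      filter_upwards [mt] with τ hτ
      simp only [bb_time] at hτ
      simpa using hτ)
    have h6 : ∑ k, (-1) / b k = - Y := by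
      rw [hY, ← Finset.sum_neg_distrib]
      exact Finset.sum_congr rfl fun k _ => by ring
    rw [h6] at h5
    linarith
  -- space
  have I2 : ∀ w, ∑ ε, wt ε * qf (u t) (x + sh e s ε) w ≤
      c * A₀ * (α * F * (10 * ‖w‖ ^ 2 * Y)) := by
    intro w
    have h1 : SymD2 (fun τ => VV u e t (x + τ • w) s)
        (∑ ε, wt ε * qf (u t) (x + sh e s ε) w) := by
      unfold VV
      apply SymD2.sum
      intro ε _
      apply SymD2.const_mul
      have := symD2_line (hdx _ (hQ ε)) w
      simpa only [add_right_comm] using this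
    have h3 := bar_symD2 b (fun _ => 2 * inner ℝ (x - x₀) w) (fun _ => ‖w‖ ^ 2) hb0 α
    have h4 := h1.sub (h3.const_mul (c * A₀))
    have h5 := h4.nonpos (by
      filter_upwards [mx w] with τ hτ
      simp only [bb_space] at hτ
      simpa using hτ)
    have hcs := real_inner_mul_inner_self_le (x - x₀) w
    have h6 := bar_x b m (‖w‖ ^ 2) (2 * inner ℝ (x - x₀) w) α hb0 hmb (sq_nonneg _) (by
      rw [real_inner_self_eq_norm_sq, real_inner_self_eq_norm_sq] at hcs
      nlinarith [sq_nonneg ‖w‖]) hα1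
    have h7 := mul_le_mul_of_nonneg_left h6 (show 0 ≤ c * A₀ * (α * F) by positivity)
    linarith
  -- parameters
  have I3 : ∀ j, ∑ ε, wt ε * qf (u t) (x + sh e s ε) (e j) ≤
      c * A₀ * (α * F * ((2 + 24 / (1 - α)) * Y - 2 * D * (1 / b j) -
        (1 - α) / 2 * (D * (1 - 2 * s j) / b j) ^ 2)) := by
    intro j
    have h1 : SymD2 (fun τ => VV u e t x (Function.update s j (s j + τ)))
        (∑ ε, wt ε * qf (u t) (x + sh e s ε) (e j)) := by
      unfold VV
      apply SymD2.sum
      intro ε _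
      apply SymD2.const_mul
      have := symD2_line (hdx _ (hQ ε)) (sg (ε j) • e j)
      rw [qf_sg] at this
      simpa only [sh_update, ← add_assoc] using this
    have h3 := bar_symD2 b (fun k => 2 * s j + if k = j then D * (1 - 2 * s j) else 0)
      (fun k => 1 - if k = j then D else 0) hb0 α
    have h4 := h1.sub (h3.const_mul (c * A₀))
    have h5 := h4.nonpos (by
      filter_upwards [ms j] with τ hτ
      simp only [bb_s] at hτ
      simpa using hτ)
    have h6 := bar_s b j m D (s j) α hb0 hmb (hs0 j).le (hs j) (hsm j) (by linarith) hα0 hα1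
    have h7 := mul_le_mul_of_nonneg_left h6 (show 0 ≤ c * A₀ * (α * F) by positivity)
    linarith
  -- combine
  have hL : ∑ ε, wt ε * frz A u t (x + sh e s ε) =
      ∑ ε, wt ε * td u t (x + sh e s ε) -
      ∑ k, ∑ ε, wt ε * qf (u t) (x + sh e s ε) (v k) -
      (ν / 3) * ∑ k, ∑ ε, wt ε * qf (u t) (x + sh e s ε) (e k) := by
    simp only [frz_decomp hv, mul_sub, Finset.sum_sub_distrib]
    rw [Finset.sum_comm (s := Finset.univ (α := Fin d)), Finset.sum_comm (s := Finset.univ (α := Fin 3)),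
      Finset.mul_sum]
    simp only [Finset.mul_sum]
    congr 1
    refine Finset.sum_congr rfl fun ε _ => Finset.sum_congr rfl fun k _ => ?_
    ring
  have J2 : ∑ k, ∑ ε, wt ε * qf (u t) (x + sh e s ε) (v k) ≤
      c * A₀ * (α * F * (10 * (d * ν⁻¹) * Y)) := by
    calc _ ≤ ∑ k, c * A₀ * (α * F * (10 * ‖v k‖ ^ 2 * Y)) := Finset.sum_le_sum fun k _ => I2 (v k)
      _ = c * A₀ * (α * F * (10 * Y)) * ∑ k, ‖v k‖ ^ 2 := by
          rw [Finset.mul_sum]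
          exact Finset.sum_congr rfl fun k _ => by ring
      _ ≤ c * A₀ * (α * F * (10 * Y)) * (d * ν⁻¹) :=
          mul_le_mul_of_nonneg_left hvn (by positivity)
      _ = _ := by ring
  have hS : ∑ k, (1 / b k) ^ 2 ≤ ∑ k, (D * (1 - 2 * s k) / b k) ^ 2 := by
    refine Finset.sum_le_sum fun k _ => ?_
    apply pow_le_pow_left₀ (one_div_pos.2 (hb0 k)).le
    apply div_le_div_of_nonneg_right _ (hb0 k).le
    nlinarith [hs k]
  have J3 : ∑ k, ∑ ε, wt ε * qf (u t) (x + sh e s ε) (e k) ≤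
      c * A₀ * (α * F * ((6 + 72 / (1 - α) - 2 * D) * Y - (1 - α) / 2 * ∑ k, (1 / b k) ^ 2)) := by
    calc _ ≤ ∑ k, c * A₀ * (α * F * ((2 + 24 / (1 - α)) * Y - 2 * D * (1 / b k) -
        (1 - α) / 2 * (D * (1 - 2 * s k) / b k) ^ 2)) := Finset.sum_le_sum fun k _ => I3 k
      _ = c * A₀ * (α * F) * ((6 + 72 / (1 - α) - 2 * D) * Y -
          (1 - α) / 2 * ∑ k, (D * (1 - 2 * s k) / b k) ^ 2) := by
          rw [hY]
          simp only [Fin.sum_univ_three]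
          ring
      _ ≤ c * A₀ * (α * F) * ((6 + 72 / (1 - α) - 2 * D) * Y -
          (1 - α) / 2 * ∑ k, (1 / b k) ^ 2) := by
          apply mul_le_mul_of_nonneg_left _ (by positivity)
          have : 0 ≤ (1 - α) / 2 := by linarith
          nlinarith
      _ = _ := by ring
  obtain ⟨j, hj⟩ := bar_low b hb0 δ hδ0
  rw [← hα, ← hF] at hj
  have hsj : s j ^ δ ≤ b j ^ δ := Real.rpow_le_rpow (hs0 j).le (hsb j) hδ0.le
  have hsj0 : 0 < s j ^ δ := Real.rpow_pos_of_pos (hs0 j) _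
  have hup := pair_le j (fun ε => frz A u t (x + sh e s ε)) (A₀ * (2 * s j ^ δ)) (by
    intro ε
    refine (hAf _ (Finset.mem_image_of_mem _ (Finset.mem_univ _)) _
      (Finset.mem_image_of_mem _ (Finset.mem_univ _))).trans ?_
    apply mul_le_mul_of_nonneg_left _ hA₀.le
    have hd : dist (sh e s ε) (sh e s (flp j ε)) ≤ 2 * s j := by
      rw [dist_eq_norm, sh_flp, norm_smul, Real.norm_eq_abs, abs_mul, abs_mul, abs_sg,
        abs_of_pos (hs0 j), abs_of_pos (by norm_num : (0 : ℝ) < 2)]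
      nlinarith [he j, hs0 j]
    calc dist (sh e s ε) (sh e s (flp j ε)) ^ δ ≤ (2 * s j) ^ δ :=
          Real.rpow_le_rpow dist_nonneg hd hδ0.le
      _ = 2 ^ δ * s j ^ δ := Real.mul_rpow (by norm_num) (hs0 j).le
      _ ≤ 2 * s j ^ δ := by
          apply mul_le_mul_of_nonneg_right _ hsj0.le
          calc (2 : ℝ) ^ δ ≤ 2 ^ (1 : ℝ) := Real.rpow_le_rpow_of_exponent_le (by norm_num) hδ1.le
            _ = 2 := Real.rpow_one 2)
  have hup' := (abs_le.1 hup).2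
  rw [hL] at hup'
  set S := ∑ k, (1 / b k) ^ 2 with hSdef
  have hpos : 0 < c * A₀ * (α * F) := by positivity
  have K1 : c * A₀ * (α * F) * ((ν / 3) * ((1 - α) / 2) * S) ≤
      4 * (A₀ * (2 * s j ^ δ)) := by
    have h1 := mul_le_mul_of_nonneg_left J3 (show 0 ≤ ν / 3 by positivity)
    have h2 := mul_le_mul_of_nonneg_left (mul_le_mul_of_nonneg_right hD hY0.le) hpos.le
    linarith
  have K2 : s j ^ δ ≤ F * S := hsj.trans hj
  have h1α : 0 < 1 - α := by linarith
  have K3 : c * A₀ * (α * (ν / 3) * ((1 - α) / 2)) * s j ^ δ ≤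
      c * A₀ * (α * (ν / 3) * ((1 - α) / 2)) * (F * S) :=
    mul_le_mul_of_nonneg_left K2 (by positivity)
  have K4 : 8 * (A₀ * s j ^ δ) < c * (α * (ν / 3) * ((1 - α) / 2)) * (A₀ * s j ^ δ) :=
    mul_lt_mul_of_pos_right hc (by positivity)
  linarith

end

section
variable {d : ℕ}

lemma bb_continuous (D t₀ : ℝ) (x₀ : EuclideanSpace ℝ (Fin d)) (k : Fin 3) :
    Continuous fun p : ℝ × EuclideanSpace ℝ (Fin d) × (Fin 3 → ℝ) =>
      bb D t₀ x₀ p.1 p.2.1 p.2.2 k := by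
  unfold bb
  fun_prop

lemma VV_zero (u : ℝ → EuclideanSpace ℝ (Fin d) → ℝ) (e : Fin 3 → EuclideanSpace ℝ (Fin d))
    (t : ℝ) (x : EuclideanSpace ℝ (Fin d)) (s : Fin 3 → ℝ) (j : Fin 3) (hj : s j = 0) :
    VV u e t x s = 0 := by
  have := pair_le j (fun ε => u t (x + sh e s ε)) 0 (by
    intro ε
    have h := sh_flp e s ε j
    rw [hj, mul_zero, zero_smul, sub_eq_zero] at h
    simp [h])
  simpa [VV] using this

lemma compare {q : ℕ} {ν δ A₀ D c : ℝ} (hν : 0 < ν) (hδ0 : 0 < δ) (hδ1 : δ < 1)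
    (hA₀ : 0 < A₀) {u : ℝ → EuclideanSpace ℝ (Fin d) → ℝ} (hu : Good d q ν δ A₀ u)
    (hD2 : 2 ≤ D)
    (hD : 1 + 10 * (d * ν⁻¹) ≤ (ν / 3) * (2 * D - 6 - 72 / (1 - (2 + δ) / 3)))
    (hc0 : 0 < c)
    (hc : 8 < c * ((2 + δ) / 3 * (ν / 3) * ((1 - (2 + δ) / 3) / 2)))
    (hc8 : 8 * 16 ^ 6 ≤ c)
    (e : Fin 3 → EuclideanSpace ℝ (Fin d)) (he : ∀ k, ‖e k‖ ≤ 1)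
    (he' : ∀ j, ∀ k : Fin d, q ≤ (k : ℕ) → e j k = 0)
    (t₀ : ℝ) (x₀ : EuclideanSpace ℝ (Fin d)) (s₀ : Fin 3 → ℝ)
    (ht₀ : -(1 / 2) < t₀) (ht₀' : t₀ < 0) (hx₀ : ‖x₀‖ < 5 / 8)
    (hs₀ : ∀ j, 0 ≤ s₀ j) (hs₀' : ∀ j, s₀ j ≤ 1 / 16) :
    VV u e t₀ x₀ s₀ ≤ c * A₀ * (∏ k, bb D t₀ x₀ t₀ x₀ s₀ k) ^ ((2 + δ) / 3) := by
  have hα0 : 0 < (2 + δ) / 3 := by positivity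
  have hα1 : (2 + δ) / 3 ≤ 1 := by linarith
  have hu' := hu
  obtain ⟨⟨-, -, huc, -, -, -⟩, -, hM⟩ := hu'
  let Ω : Set (ℝ × EuclideanSpace ℝ (Fin d) × (Fin 3 → ℝ)) :=
    Icc (t₀ - 1 / 256) t₀ ×ˢ closedBall x₀ (1 / 16) ×ˢ Set.pi univ fun _ => Icc 0 (1 / 16)
  have hΩ : IsCompact Ω := isCompact_Icc.prod
    ((isCompact_closedBall _ _).prod (isCompact_univ_pi fun _ => isCompact_Icc))
  have memΩ : ∀ t x s, (t, x, s) ∈ Ω ↔ (t₀ - 1 / 256 ≤ t ∧ t ≤ t₀) ∧ ‖x - x₀‖ ≤ 1 / 16 ∧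
      ∀ j, 0 ≤ s j ∧ s j ≤ 1 / 16 := by
    intro t x s
    simp only [Ω, mem_prod, mem_Icc, mem_closedBall, dist_eq_norm, Set.mem_pi, mem_univ, true_imp_iff]
  have hQ : ∀ p ∈ Ω, ∀ ε, (p.1, p.2.1 + sh e p.2.2 ε) ∈ parQ d 1 := by
    rintro ⟨t, x, s⟩ hp ε
    rw [memΩ] at hp
    obtain ⟨⟨h1, h2⟩, h3, h4⟩ := hp
    simp only [parQ, mem_prod, mem_Ioo, mem_ball_zero_iff]
    refine ⟨⟨by linarith, by linarith⟩, ?_⟩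
    have h5 := norm_sh_le he (r := 1 / 16) (s := s)
      (fun j => by rw [abs_of_nonneg (h4 j).1]; exact (h4 j).2) ε
    have h6 := norm_add_le x (sh e s ε)
    have h7 := norm_add_le (x - x₀) x₀
    rw [sub_add_cancel] at h7
    linarith
  let W : ℝ × EuclideanSpace ℝ (Fin d) × (Fin 3 → ℝ) → ℝ := fun p =>
    VV u e p.1 p.2.1 p.2.2 - c * A₀ * (∏ k, bb D t₀ x₀ p.1 p.2.1 p.2.2 k) ^ ((2 + δ) / 3)
  have hWc : ContinuousOn W Ω := by
    apply ContinuousOn.sub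
    · unfold VV
      apply continuousOn_finsetSum
      intro ε _
      apply ContinuousOn.mul continuousOn_const
      have hcm : Continuous fun p : ℝ × EuclideanSpace ℝ (Fin d) × (Fin 3 → ℝ) =>
          (p.1, p.2.1 + sh e p.2.2 ε) := by
        unfold sh
        fun_prop
      exact huc.comp hcm.continuousOn (fun p hp => hQ p hp ε)
    · apply Continuous.continuousOn
      apply Continuous.mul continuous_const
      apply Continuous.rpow_const
      · exact continuous_finsetProd _ fun k _ => bb_continuous D t₀ x₀ k
      · exact fun _ => Or.inr hα0.le
  by_contra hcon
  push Not at hcon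
  have hp₀ : (t₀, x₀, s₀) ∈ Ω := by
    rw [memΩ]
    exact ⟨⟨by linarith, le_rfl⟩, by simp, fun j => ⟨hs₀ j, hs₀' j⟩⟩
  obtain ⟨⟨t, x, s⟩, hp, hmax⟩ := hΩ.exists_isMaxOn ⟨_, hp₀⟩ hWc
  have hWpos : 0 < W (t, x, s) := by
    have h1 : W (t₀, x₀, s₀) ≤ W (t, x, s) := hmax hp₀
    have h2 : 0 < W (t₀, x₀, s₀) := by simp only [W]; linarith
    linarith
  have hp' := hp
  rw [memΩ] at hp'
  obtain ⟨⟨h1, h2⟩, h3, h4⟩ := hp'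
  have hsnn : ∀ j, 0 ≤ s j ^ 2 := fun j => sq_nonneg _
  have hS0 : 0 ≤ ∑ j, s j ^ 2 := Finset.sum_nonneg fun j _ => hsnn j
  have hbm : ∀ k, ‖x - x₀‖ ^ 2 + (t₀ - t) + ∑ j, s j ^ 2 ≤ bb D t₀ x₀ t x s k := by
    intro k
    unfold bb
    have : 0 ≤ D * (s k * (1 - s k)) :=
      mul_nonneg (by linarith) (mul_nonneg (h4 k).1 (by linarith [(h4 k).2]))
    linarith
  have hb0 : ∀ k, 0 ≤ bb D t₀ x₀ t x s k := fun k =>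
    le_trans (by have := sq_nonneg ‖x - x₀‖; linarith) (hbm k)
  have hF0 : 0 ≤ (∏ k, bb D t₀ x₀ t x s k) ^ ((2 + δ) / 3) :=
    Real.rpow_nonneg (Finset.prod_nonneg fun k _ => hb0 k) _
  -- size of V
  have hV : VV u e t x s ≤ 8 * A₀ := by
    have h5 := pair_le 0 (fun ε => u t (x + sh e s ε)) (2 * A₀) (by
      intro ε
      have a1 := hM _ (hQ _ hp ε)
      have a2 := hM _ (hQ _ hp (flp 0 ε))
      rw [abs_le] at a1 a2 ⊢
      simp only at a1 a2
      constructor <;> linarith [a1.1, a1.2, a2.1, a2.2])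
    have := (abs_le.1 h5).2
    unfold VV
    linarith
  -- not on the lateral boundary
  have hm : ‖x - x₀‖ ^ 2 + (t₀ - t) + ∑ j, s j ^ 2 < 1 / 256 := by
    by_contra hge
    push Not at hge
    have h5 : (1 / 16 ^ 6 : ℝ) ≤ ∏ k, bb D t₀ x₀ t x s k := by
      have := Finset.prod_le_prod (s := Finset.univ) (f := fun _ : Fin 3 => (1 / 256 : ℝ))
        (g := bb D t₀ x₀ t x s) (fun _ _ => by norm_num) (fun k _ => hge.trans (hbm k))
      refine le_trans ?_ this
      simp
      norm_num
    have h6 : (1 / 16 ^ 6 : ℝ) ≤ (∏ k, bb D t₀ x₀ t x s k) ^ ((2 + δ) / 3) :=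
      calc (1 / 16 ^ 6 : ℝ) = (1 / 16 ^ 6 : ℝ) ^ (1 : ℝ) := (Real.rpow_one _).symm
        _ ≤ (1 / 16 ^ 6 : ℝ) ^ ((2 + δ) / 3) :=
          Real.rpow_le_rpow_of_exponent_ge (by norm_num) (by norm_num) hα1
        _ ≤ _ := Real.rpow_le_rpow (by norm_num) h5 hα0.le
    have h7 : 8 * A₀ ≤ c * A₀ * (1 / 16 ^ 6) := by
      have := mul_le_mul_of_nonneg_right hc8 hA₀.le
      norm_num at this ⊢
      linarith
    have h8 := mul_le_mul_of_nonneg_left h6 (show 0 ≤ c * A₀ by positivity)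
    simp only [W] at hWpos
    linarith
  have hspos : ∀ j, 0 < s j := by
    intro j
    rcases (h4 j).1.lt_or_eq with h | h
    · exact h
    · exfalso
      have h5 := VV_zero u e t x s j h.symm
      simp only [W, h5] at hWpos
      have : 0 ≤ c * A₀ * (∏ k, bb D t₀ x₀ t x s k) ^ ((2 + δ) / 3) := by positivity
      linarith
  have hsq : ∀ j, s j ^ 2 ≤ ∑ j, s j ^ 2 := fun j =>
    Finset.single_le_sum (f := fun j => s j ^ 2) (fun _ _ => sq_nonneg _) (Finset.mem_univ j)
  have hslt : ∀ j, s j < 1 / 16 := by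
    intro j
    have := hsq j
    have := sq_nonneg ‖x - x₀‖
    nlinarith [hspos j]
  have hxlt : ‖x - x₀‖ < 1 / 16 := by
    nlinarith [norm_nonneg (x - x₀)]
  have htlt : t₀ - 1 / 256 < t := by
    have := sq_nonneg ‖x - x₀‖
    linarith
  refine no_interior_max hν hδ0 hδ1 hA₀ hu hD2 hD hc0 hc e he he' t₀ t x₀ x s h2 hspos
    (fun j => (hslt j).le) (hQ _ hp) ?_ ?_ ?_
  · have hev : ∀ᶠ τ in nhds (0 : ℝ), t₀ - 1 / 256 < t + τ := by
      have hcm : Continuous fun τ : ℝ => t + τ := by fun_prop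
      exact (hcm.tendsto 0).eventually (lt_mem_nhds (by simpa using htlt))
    filter_upwards [hev.filter_mono nhdsWithin_le_nhds, self_mem_nhdsWithin] with τ hτ hτ0
    have hτ0 : τ < 0 := hτ0
    exact hmax (show (t + τ, x, s) ∈ Ω by
      rw [memΩ]
      exact ⟨⟨hτ.le, by linarith⟩, h3, h4⟩)
  · intro v
    have hev : ∀ᶠ τ in nhds (0 : ℝ), ‖x + τ • v - x₀‖ < 1 / 16 := by
      have hcm : Continuous fun τ : ℝ => ‖x + τ • v - x₀‖ := by fun_prop
      exact (hcm.tendsto 0).eventually (gt_mem_nhds (by simpa using hxlt))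
    filter_upwards [hev] with τ hτ
    exact hmax (show (t, x + τ • v, s) ∈ Ω by
      rw [memΩ]
      exact ⟨⟨h1, h2⟩, hτ.le, h4⟩)
  · intro j
    have hcm : Continuous fun τ : ℝ => s j + τ := by fun_prop
    have hev1 : ∀ᶠ τ in nhds (0 : ℝ), 0 < s j + τ :=
      (hcm.tendsto 0).eventually (lt_mem_nhds (by simpa using hspos j))
    have hev2 : ∀ᶠ τ in nhds (0 : ℝ), s j + τ < 1 / 16 :=
      (hcm.tendsto 0).eventually (gt_mem_nhds (by simpa using hslt j))
    filter_upwards [hev1, hev2] with τ hτ1 hτ2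
    exact hmax (show (t, x, Function.update s j (s j + τ)) ∈ Ω by
      rw [memΩ]
      refine ⟨⟨h1, h2⟩, h3, fun k => ?_⟩
      by_cases hk : k = j
      · subst hk
        simp only [Function.update_self]
        exact ⟨hτ1.le, hτ2.le⟩
      · rw [Function.update_of_ne hk]
        exact h4 k)

lemma VV_neg (u : ℝ → EuclideanSpace ℝ (Fin d) → ℝ) (e : Fin 3 → EuclideanSpace ℝ (Fin d))
    (t : ℝ) (x : EuclideanSpace ℝ (Fin d)) (s : Fin 3 → ℝ) :
    VV u (Function.update e 0 (-e 0)) t x s = - VV u e t x s := by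
  unfold VV
  rw [← Equiv.sum_comp (flp_flp 0).toPerm
    (fun ε => wt ε * u t (x + sh (Function.update e 0 (-e 0)) s ε)), ← Finset.sum_neg_distrib]
  refine Finset.sum_congr rfl fun ε _ => ?_
  have : ∀ b, sg (!b) = - sg b := by intro b; cases b <;> simp [sg]
  have h : sh (Function.update e 0 (-e 0)) s (flp 0 ε) = sh e s ε := by
    simp [sh, flp, Fin.sum_univ_three, Function.update, this]
  simp [Function.Involutive.coe_toPerm, wt_flp, h]

/-- The third difference estimate. -/
lemma third_diff (d q : ℕ) (ν δ : ℝ) (hν : 0 < ν) (hδ0 : 0 < δ) (hδ1 : δ < 1) :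
    ∃ C : ℝ, 0 < C ∧ ∀ (A₀ : ℝ) (u : ℝ → EuclideanSpace ℝ (Fin d) → ℝ), 0 < A₀ →
      Good d q ν δ A₀ u → ∀ (e : Fin 3 → EuclideanSpace ℝ (Fin d)), (∀ k, ‖e k‖ ≤ 1) →
      (∀ j, ∀ k : Fin d, q ≤ (k : ℕ) → e j k = 0) →
      ∀ (t : ℝ) (x : EuclideanSpace ℝ (Fin d)) (s : ℝ), -(1 / 2) < t → t < 0 → ‖x‖ < 5 / 8 →
      0 < s → s ≤ 1 / 16 → |VV u e t x (fun _ => s)| ≤ C * A₀ * s ^ (2 + δ) := by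
  set α := (2 + δ) / 3 with hα
  have hα1 : 0 < 1 - α := by rw [hα]; linarith
  have hα0 : 0 < α := by positivity
  have h72 : 0 < 72 / (1 - α) := by positivity
  let D : ℝ := 2 + 6 + 72 / (1 - α) + (1 + 10 * (d * ν⁻¹)) * (3 / ν)
  have hDp : 0 ≤ (1 + 10 * (d * ν⁻¹)) * (3 / ν) := by positivity
  have hD2 : 2 ≤ D := by simp only [D]; linarith
  have hD : 1 + 10 * (d * ν⁻¹) ≤ (ν / 3) * (2 * D - 6 - 72 / (1 - α)) := by
    calc 1 + 10 * (d * ν⁻¹) = (ν / 3) * ((1 + 10 * (d * ν⁻¹)) * (3 / ν)) := by field_simp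
      _ ≤ _ := mul_le_mul_of_nonneg_left (by simp only [D]; linarith) (by positivity)
  let l : ℝ := α * (ν / 3) * ((1 - α) / 2)
  have hl : 0 < l := by positivity
  let c : ℝ := 9 / l + 8 * 16 ^ 6
  have hc0 : 0 < c := by positivity
  have hc8 : 8 * 16 ^ 6 ≤ c := by
    have : 0 < 9 / l := by positivity
    simp only [c]
    linarith
  have hc : 8 < c * l := by
    have : c * l = 9 + 8 * 16 ^ 6 * l := by simp only [c]; field_simp
    rw [this]
    have : 0 < 8 * 16 ^ 6 * l := by positivity
    linarith
  refine ⟨c * (D + 1) ^ (2 + δ), by positivity, ?_⟩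
  intro A₀ u hA₀ hu e he he' t x s ht ht' hx hs hs'
  have hF : (∏ k, bb D t x t x (fun _ => s) k) ^ α ≤ (D + 1) ^ (2 + δ) * s ^ (2 + δ) := by
    have hb : ∀ k, bb D t x t x (fun _ => s) k = 3 * s ^ 2 + D * (s * (1 - s)) := by
      intro k
      simp [bb]
    simp only [hb]
    rw [← Real.mul_rpow (by linarith) hs.le]
    have h1 : 0 ≤ 3 * s ^ 2 + D * (s * (1 - s)) := by
      have : 0 ≤ D * (s * (1 - s)) := mul_nonneg (by linarith) (mul_nonneg hs.le (by linarith))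
      positivity
    have h2 : 3 * s ^ 2 + D * (s * (1 - s)) ≤ (D + 1) * s := by nlinarith
    have h3 : ∏ _k : Fin 3, (3 * s ^ 2 + D * (s * (1 - s))) ≤ ((D + 1) * s) ^ 3 := by
      simp only [Finset.prod_const, Finset.card_univ, Fintype.card_fin]
      exact pow_le_pow_left₀ h1 h2 3
    refine (Real.rpow_le_rpow (Finset.prod_nonneg fun _ _ => h1) h3 hα0.le).trans (le_of_eq ?_)
    rw [← Real.rpow_natCast, ← Real.rpow_mul (by positivity)]
    congr 1
    rw [hα]
    push_cast
    ring
  have hcF : c * A₀ * (∏ k, bb D t x t x (fun _ => s) k) ^ α ≤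
      c * (D + 1) ^ (2 + δ) * A₀ * s ^ (2 + δ) := by
    have := mul_le_mul_of_nonneg_left hF (show 0 ≤ c * A₀ by positivity)
    linarith
  have u1 := compare hν hδ0 hδ1 hA₀ hu hD2 hD hc0 hc hc8 e he he' t x (fun _ => s) ht ht' hx
    (fun _ => hs.le) (fun _ => hs')
  have u2 := compare hν hδ0 hδ1 hA₀ hu hD2 hD hc0 hc hc8 (Function.update e 0 (-e 0))
    (by
      intro k
      by_cases hk : k = 0
      · subst hk
        simpa using he 0
      · rw [Function.update_of_ne hk]
        exact he k)
    (by
      intro j k hk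
      by_cases hj : j = 0
      · subst hj
        simp [he' 0 k hk]
      · rw [Function.update_of_ne hj]
        exact he' j k hk) t x (fun _ => s) ht ht' hx
    (fun _ => hs.le) (fun _ => hs')
  rw [VV_neg] at u2
  rw [abs_le]
  constructor <;> linarith

end


/-- Symmetric second difference. -/
def S2 {d : ℕ} (v : EuclideanSpace ℝ (Fin d) → ℝ) (x e : EuclideanSpace ℝ (Fin d)) (s : ℝ) : ℝ :=
  v (x + s • e) + v (x + (-s) • e) - 2 * v (x + (0 : ℝ) • e)

lemma VV_expand {d : ℕ} (u : ℝ → EuclideanSpace ℝ (Fin d) → ℝ)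
    (a b c : EuclideanSpace ℝ (Fin d)) (t : ℝ) (x : EuclideanSpace ℝ (Fin d)) (s : ℝ) :
    VV u ![a, b, c] t x (fun _ => s) =
      u t (x + (s • a + s • b + s • c)) - u t (x + (s • a + s • b + (-s) • c))
      - u t (x + (s • a + (-s) • b + s • c)) + u t (x + (s • a + (-s) • b + (-s) • c))
      - u t (x + ((-s) • a + s • b + s • c)) + u t (x + ((-s) • a + s • b + (-s) • c))
      + u t (x + ((-s) • a + (-s) • b + s • c)) - u t (x + ((-s) • a + (-s) • b + (-s) • c)) := by
  have hun : (Finset.univ : Finset (Fin 3 → Bool)) =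
      {![true, true, true], ![true, true, false], ![true, false, true], ![true, false, false],
       ![false, true, true], ![false, true, false], ![false, false, true],
       ![false, false, false]} := by decide
  unfold VV
  rw [hun]
  rw [Finset.sum_insert (by decide), Finset.sum_insert (by decide), Finset.sum_insert (by decide),
    Finset.sum_insert (by decide), Finset.sum_insert (by decide), Finset.sum_insert (by decide),
    Finset.sum_insert (by decide), Finset.sum_singleton]
  simp only [wt, sh, sg, Fin.sum_univ_three, Fin.prod_univ_three, Matrix.cons_val_zero,
    Matrix.cons_val_one, Matrix.cons_val]
  simp only [if_true, Bool.false_eq_true, if_false, one_mul, mul_one, neg_mul, mul_neg, neg_neg]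
  ring

lemma identA {d : ℕ} (u : ℝ → EuclideanSpace ℝ (Fin d) → ℝ)
    (e : EuclideanSpace ℝ (Fin d)) (t : ℝ) (x : EuclideanSpace ℝ (Fin d)) (s : ℝ) :
    S2 (u t) x e (2 * s) - 4 * S2 (u t) x e s =
      VV u ![e, e, e] t (x + (s / 2) • e) (fun _ => s / 2) -
      VV u ![e, e, e] t (x - (s / 2) • e) (fun _ => s / 2) := by
  have key : ∀ (y z : EuclideanSpace ℝ (Fin d)), y = z → u t y = u t z := fun y z h => by rw [h]
  rw [VV_expand, VV_expand]
  unfold S2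
  rw [key (x + (s / 2) • e + ((s / 2) • e + (s / 2) • e + (s / 2) • e)) (x + (2 * s) • e)
      (by module),
    key (x + (s / 2) • e + ((s / 2) • e + (s / 2) • e + (-(s / 2)) • e)) (x + s • e) (by module),
    key (x + (s / 2) • e + ((s / 2) • e + (-(s / 2)) • e + (s / 2) • e)) (x + s • e) (by module),
    key (x + (s / 2) • e + ((s / 2) • e + (-(s / 2)) • e + (-(s / 2)) • e)) (x + (0 : ℝ) • e)
      (by module),
    key (x + (s / 2) • e + ((-(s / 2)) • e + (s / 2) • e + (s / 2) • e)) (x + s • e) (by module),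
    key (x + (s / 2) • e + ((-(s / 2)) • e + (s / 2) • e + (-(s / 2)) • e)) (x + (0 : ℝ) • e)
      (by module),
    key (x + (s / 2) • e + ((-(s / 2)) • e + (-(s / 2)) • e + (s / 2) • e)) (x + (0 : ℝ) • e)
      (by module),
    key (x + (s / 2) • e + ((-(s / 2)) • e + (-(s / 2)) • e + (-(s / 2)) • e)) (x + (-s) • e)
      (by module),
    key (x - (s / 2) • e + ((s / 2) • e + (s / 2) • e + (s / 2) • e)) (x + s • e)
      (by module),
    key (x - (s / 2) • e + ((s / 2) • e + (s / 2) • e + (-(s / 2)) • e)) (x + (0 : ℝ) • e)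
      (by module),
    key (x - (s / 2) • e + ((s / 2) • e + (-(s / 2)) • e + (s / 2) • e)) (x + (0 : ℝ) • e)
      (by module),
    key (x - (s / 2) • e + ((s / 2) • e + (-(s / 2)) • e + (-(s / 2)) • e)) (x + (-s) • e)
      (by module),
    key (x - (s / 2) • e + ((-(s / 2)) • e + (s / 2) • e + (s / 2) • e)) (x + (0 : ℝ) • e)
      (by module),
    key (x - (s / 2) • e + ((-(s / 2)) • e + (s / 2) • e + (-(s / 2)) • e)) (x + (-s) • e)
      (by module),
    key (x - (s / 2) • e + ((-(s / 2)) • e + (-(s / 2)) • e + (s / 2) • e)) (x + (-s) • e)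
      (by module),
    key (x - (s / 2) • e + ((-(s / 2)) • e + (-(s / 2)) • e + (-(s / 2)) • e)) (x + (-(2 * s)) • e)
      (by module)]
  ring

lemma identB {d : ℕ} (u : ℝ → EuclideanSpace ℝ (Fin d) → ℝ)
    (e g : EuclideanSpace ℝ (Fin d)) (t : ℝ) (x : EuclideanSpace ℝ (Fin d)) (s : ℝ) :
    S2 (u t) (x + (s / 2) • g) e s - S2 (u t) (x - (s / 2) • g) e s =
      VV u ![e, e, g] t x (fun _ => s / 2) := by
  have key : ∀ (y z : EuclideanSpace ℝ (Fin d)), y = z → u t y = u t z := fun y z h => by rw [h]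
  rw [VV_expand]
  unfold S2
  rw [key (x + ((s / 2) • e + (s / 2) • e + (s / 2) • g)) (x + (s / 2) • g + s • e) (by module),
    key (x + ((s / 2) • e + (s / 2) • e + (-(s / 2)) • g)) (x - (s / 2) • g + s • e) (by module),
    key (x + ((s / 2) • e + (-(s / 2)) • e + (s / 2) • g)) (x + (s / 2) • g + (0 : ℝ) • e)
      (by module),
    key (x + ((s / 2) • e + (-(s / 2)) • e + (-(s / 2)) • g)) (x - (s / 2) • g + (0 : ℝ) • e)
      (by module),
    key (x + ((-(s / 2)) • e + (s / 2) • e + (s / 2) • g)) (x + (s / 2) • g + (0 : ℝ) • e)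
      (by module),
    key (x + ((-(s / 2)) • e + (s / 2) • e + (-(s / 2)) • g)) (x - (s / 2) • g + (0 : ℝ) • e)
      (by module),
    key (x + ((-(s / 2)) • e + (-(s / 2)) • e + (s / 2) • g)) (x + (s / 2) • g + (-s) • e)
      (by module),
    key (x + ((-(s / 2)) • e + (-(s / 2)) • e + (-(s / 2)) • g)) (x - (s / 2) • g + (-s) • e)
      (by module)]
  ring

lemma telescope {S : ℝ → ℝ} {c B δ s₀ : ℝ} (hδ : 0 < δ) (hB : 0 ≤ B)
    (hlim : Tendsto (fun s => S s / s ^ 2) (nhdsWithin 0 (Ioi 0)) (nhds c))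
    (hS : ∀ s, 0 < s → s ≤ s₀ → |S (2 * s) - 4 * S s| ≤ B * s ^ (2 + δ)) :
    ∀ s, 0 < s → s ≤ s₀ → |S s / s ^ 2 - c| ≤ B / (1 - (1 / 2 : ℝ) ^ δ) * s ^ δ := by
  intro s hs hs0
  set r : ℝ := (1 / 2 : ℝ) ^ δ with hr
  have hr0 : 0 < r := by positivity
  have hr1 : r < 1 := Real.rpow_lt_one (by norm_num) (by norm_num) hδ
  have hr1' : 0 < 1 - r := by linarith
  have step : ∀ σ, 0 < σ → σ ≤ s₀ → |S (2 * σ) / (2 * σ) ^ 2 - S σ / σ ^ 2| ≤ B * σ ^ δ := by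
    intro σ h0 h1
    have e : S (2 * σ) / (2 * σ) ^ 2 - S σ / σ ^ 2 = (S (2 * σ) - 4 * S σ) / (4 * σ ^ 2) := by
      field_simp
      ring
    rw [e, abs_div, abs_of_pos (by positivity : 0 < 4 * σ ^ 2), div_le_iff₀ (by positivity)]
    refine (hS σ h0 h1).trans ?_
    rw [Real.rpow_add h0, Real.rpow_two]
    have : 0 ≤ B * (σ ^ 2 * σ ^ δ) := by positivity
    nlinarith
  have ind : ∀ n : ℕ, |S s / s ^ 2 - S (s * (1 / 2) ^ n) / (s * (1 / 2) ^ n) ^ 2| ≤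
      B * s ^ δ * ((1 - r ^ n) / (1 - r)) := by
    intro n
    induction n with
    | zero => simp
    | succ n ih =>
      have hp : 0 < s * (1 / 2 : ℝ) ^ (n + 1) := by positivity
      have hle : s * (1 / 2 : ℝ) ^ (n + 1) ≤ s₀ := by
        have : (1 / 2 : ℝ) ^ (n + 1) ≤ 1 := pow_le_one₀ (by norm_num) (by norm_num)
        nlinarith
      have h1 := step _ hp hle
      have h2 : 2 * (s * (1 / 2 : ℝ) ^ (n + 1)) = s * (1 / 2) ^ n := by ring
      rw [h2] at h1
      have h3 : (s * (1 / 2 : ℝ) ^ (n + 1)) ^ δ = s ^ δ * r ^ (n + 1) := by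
        rw [Real.mul_rpow hs.le (by positivity), hr, ← Real.rpow_natCast, ← Real.rpow_mul (by norm_num),
          mul_comm, ← Real.rpow_natCast ((1 / 2 : ℝ) ^ δ), ← Real.rpow_mul (by norm_num), mul_comm,
          mul_comm δ]
      rw [h3] at h1
      have h4 : r ^ (n + 1) ≤ r ^ n := pow_le_pow_of_le_one hr0.le hr1.le (Nat.le_succ n)
      have h5 : (1 - r ^ (n + 1)) / (1 - r) = (1 - r ^ n) / (1 - r) + r ^ n := by
        field_simp
        ring
      rw [h5, mul_add]
      have h6 : B * (s ^ δ * r ^ (n + 1)) ≤ B * s ^ δ * r ^ n := by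
        rw [← mul_assoc]; gcongr
      exact (abs_sub_le _ _ _).trans (add_le_add ih (h1.trans h6))
  have ht : Tendsto (fun n : ℕ => s * (1 / 2 : ℝ) ^ n) atTop (nhdsWithin 0 (Ioi 0)) := by
    refine tendsto_nhdsWithin_iff.2 ⟨?_, Eventually.of_forall fun n => ?_⟩
    · have := (tendsto_pow_atTop_nhds_zero_of_lt_one (r := (1 / 2 : ℝ)) (by norm_num)
        (by norm_num)).const_mul s
      simpa using this
    · exact mem_Ioi.2 (by positivity)
  have hl := ((hlim.comp ht).const_sub (S s / s ^ 2)).abs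
  refine le_of_tendsto hl (Eventually.of_forall fun n => (ind n).trans ?_)
  have : (1 - r ^ n) / (1 - r) ≤ 1 / (1 - r) := by
    gcongr
    have : 0 < r ^ n := by positivity
    linarith
  calc B * s ^ δ * ((1 - r ^ n) / (1 - r)) ≤ B * s ^ δ * (1 / (1 - r)) := by gcongr
    _ = _ := by ring

lemma qf_bound (d q : ℕ) (ν δ : ℝ) (hν : 0 < ν) (hδ0 : 0 < δ) (hδ1 : δ < 1) :
    ∃ N : ℝ, 0 < N ∧ ∀ (A₀ : ℝ) (u : ℝ → EuclideanSpace ℝ (Fin d) → ℝ), 0 < A₀ →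
      Good d q ν δ A₀ u → ∀ (e : EuclideanSpace ℝ (Fin d)), ‖e‖ ≤ 1 →
      (∀ k : Fin d, q ≤ (k : ℕ) → e k = 0) →
      ∀ (t : ℝ) (x y : EuclideanSpace ℝ (Fin d)), -(1 / 4) < t → t < 0 → ‖x‖ < 1 / 2 →
      ‖y‖ < 1 / 2 → (∀ k : Fin d, q ≤ (k : ℕ) → x k = y k) →
      |qf (u t) x e - qf (u t) y e| ≤ N * A₀ * dist x y ^ δ := by
  obtain ⟨C, hC, hT⟩ := third_diff d q ν δ hν hδ0 hδ1
  set R : ℝ := 1 - (1 / 2 : ℝ) ^ δ with hR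
  have hR0 : 0 < R := by
    have : (1 / 2 : ℝ) ^ δ < 1 := Real.rpow_lt_one (by norm_num) (by norm_num) hδ0
    linarith
  set p : ℝ := (1 / 16 : ℝ) ^ δ with hp
  have hp0 : 0 < p := by positivity
  refine ⟨(4 * C / R + C) + 2 * (1024 / p + 2 * C / R), by positivity, ?_⟩
  intro A₀ u hA hG e he hek t x y ht0 ht1 hx hy hxy
  have cube : ∀ g : EuclideanSpace ℝ (Fin d), ‖g‖ ≤ 1 → (∀ k : Fin d, q ≤ (k : ℕ) → g k = 0) →
      ∀ w : EuclideanSpace ℝ (Fin d), ‖w‖ < 5 / 8 → ∀ s : ℝ, 0 < s → s ≤ 1 / 8 →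
      |VV u ![e, e, g] t w (fun _ => s / 2)| ≤ C * A₀ * s ^ (2 + δ) := by
    intro g hg hgk w hw s hs hs1
    refine (hT A₀ u hA hG ![e, e, g] ?_ ?_ t w (s / 2) (by linarith) ht1 hw (by linarith)
      (by linarith)).trans ?_
    · intro k; fin_cases k
      · exact he
      · exact he
      · exact hg
    · intro j; fin_cases j
      · exact hek
      · exact hek
      · exact hgk
    · gcongr
      linarith
  have hcd : ∀ w : EuclideanSpace ℝ (Fin d), ‖w‖ < 1 → ContDiffAt ℝ 2 (u t) w := by
    intro w hw
    refine hG.1.2.1 (t, w) ⟨⟨by norm_num; linarith, ht1⟩, ?_⟩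
    simpa using hw
  have tele : ∀ w : EuclideanSpace ℝ (Fin d), ‖w‖ < 1 / 2 → ∀ s : ℝ, 0 < s → s ≤ 1 / 16 →
      |S2 (u t) w e s / s ^ 2 - qf (u t) w e| ≤ 2 * C * A₀ / R * s ^ δ := by
    intro w hw
    refine telescope hδ0 (by positivity) (symD2_line (hcd w (by linarith)) e) ?_
    intro s hs hs1
    rw [identA]
    have hn : ‖(s / 2) • e‖ ≤ 1 / 32 := by
      rw [norm_smul, Real.norm_of_nonneg (by linarith)]
      nlinarith [norm_nonneg e]
    have h1 := cube e he hek (w + (s / 2) • e)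
      (by linarith [norm_add_le w ((s / 2) • e)]) s hs (by linarith)
    have h2 := cube e he hek (w - (s / 2) • e)
      (by linarith [norm_sub_le w ((s / 2) • e)]) s hs (by linarith)
    refine (abs_sub _ _).trans ?_
    linarith
  rcases eq_or_ne x y with rfl | hne
  · simp only [sub_self, abs_zero]; positivity
  have hs : 0 < dist x y := dist_pos.2 hne
  set s := dist x y with hsdef
  have hK1 : 0 ≤ 4 * C / R + C := by positivity
  have hK2 : 0 ≤ 2 * (1024 / p + 2 * C / R) := by positivity
  have hsδ : 0 < s ^ δ := by positivity
  rcases le_or_gt s (1 / 16) with hle | hgt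
  · have h1 := tele x hx s hs hle
    have h2 := tele y hy s hs hle
    have h3 : |S2 (u t) x e s - S2 (u t) y e s| ≤ C * A₀ * s ^ (2 + δ) := by
      have hng : ‖x - y‖ = s := by rw [hsdef, dist_eq_norm]
      set g := s⁻¹ • (x - y) with hg
      have hsg : s • g = x - y := by rw [hg, smul_smul, mul_inv_cancel₀ hs.ne', one_smul]
      have ex : (1 / 2 : ℝ) • (x + y) + (s / 2) • g = x := by
        have : (s / 2) • g = (1 / 2 : ℝ) • (s • g) := by module
        rw [this, hsg]; module
      have ey : (1 / 2 : ℝ) • (x + y) - (s / 2) • g = y := by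
        have : (s / 2) • g = (1 / 2 : ℝ) • (s • g) := by module
        rw [this, hsg]; module
      have := identB u e g t ((1 / 2 : ℝ) • (x + y)) s
      rw [ex, ey] at this
      rw [this]
      refine cube g ?_ ?_ _ ?_ s hs (by linarith)
      · rw [hg, norm_smul, hng, norm_inv, Real.norm_of_nonneg hs.le, inv_mul_cancel₀ hs.ne']
      · intro k hk
        simp [hg, hxy k hk]
      · rw [norm_smul]
        have := norm_add_le x y
        norm_num
        linarith
    have h4 : |S2 (u t) x e s / s ^ 2 - S2 (u t) y e s / s ^ 2| ≤ C * A₀ * s ^ δ := by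
      rw [← sub_div, abs_div, abs_of_pos (by positivity : 0 < s ^ 2), div_le_iff₀ (by positivity)]
      refine h3.trans (le_of_eq ?_)
      rw [Real.rpow_add hs, Real.rpow_two]; ring
    have h5 : |qf (u t) x e - qf (u t) y e| ≤ (4 * C / R + C) * A₀ * s ^ δ := by
      have : (4 * C / R + C) * A₀ * s ^ δ =
        2 * C * A₀ / R * s ^ δ + C * A₀ * s ^ δ + 2 * C * A₀ / R * s ^ δ := by ring
      rw [this]
      rw [abs_le] at h1 h2 h4 ⊢
      constructor <;> linarith [h1.1, h1.2, h2.1, h2.2, h4.1, h4.2]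
    refine h5.trans ?_
    have h6 : 0 ≤ 2 * (1024 / p + 2 * C / R) * A₀ * s ^ δ := by positivity
    linarith
  · have big : ∀ w : EuclideanSpace ℝ (Fin d), ‖w‖ < 1 / 2 →
        |qf (u t) w e| ≤ (1024 / p + 2 * C / R) * A₀ * p := by
      intro w hw
      have h1 := tele w hw (1 / 16) (by norm_num) le_rfl
      have hub : ∀ τ : ℝ, |τ| ≤ 1 / 16 → |u t (w + τ • e)| ≤ A₀ := by
        intro τ hτ
        refine hG.2.2 (t, w + τ • e) ⟨⟨by norm_num; linarith, ht1⟩, ?_⟩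
        have : ‖τ • e‖ ≤ 1 / 16 := by
          rw [norm_smul, Real.norm_eq_abs]
          nlinarith [norm_nonneg e, abs_nonneg τ]
        have h2 := norm_add_le w (τ • e)
        simp only [mem_ball, dist_zero_right]
        linarith
      have b1 := hub (1 / 16) (by norm_num [abs_of_pos])
      have b2 := hub (-(1 / 16)) (by rw [abs_neg]; norm_num [abs_of_pos])
      have b3 := hub 0 (by norm_num)
      have h2 : |S2 (u t) w e (1 / 16)| ≤ 4 * A₀ := by
        unfold S2
        rw [abs_le] at b1 b2 b3 ⊢
        constructor <;> linarith [b1.1, b1.2, b2.1, b2.2, b3.1, b3.2]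
      have h3 : (1024 / p + 2 * C / R) * A₀ * p = 1024 * A₀ + 2 * C * A₀ / R * p := by
        field_simp
      rw [h3]
      rw [← hp] at h1
      rw [abs_le] at h1 h2 ⊢
      have h4 : S2 (u t) w e (1 / 16) / (1 / 16) ^ 2 = 256 * S2 (u t) w e (1 / 16) := by ring
      rw [h4] at h1
      constructor <;> linarith [h1.1, h1.2, h2.1, h2.2]
    have hps : p ≤ s ^ δ := by rw [hp]; gcongr
    have hx' := big x hx
    have hy' := big y hy
    have hle : (1024 / p + 2 * C / R) * A₀ * p ≤ (1024 / p + 2 * C / R) * A₀ * s ^ δ := by gcongr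
    have h0 : 0 ≤ (4 * C / R + C) * A₀ * s ^ δ := by positivity
    refine (abs_sub _ _).trans ?_
    linarith

/-- **Theorem 4.1 (ii), first case**: interior partial Schauder estimate in `x'` on the
parabolic cylinder `Q_1` for non-divergence form parabolic equations with coefficients
independent of `x'`. -/
theorem partial_schauder_parabolic_cylinder_x
    (d q : ℕ) (ν δ : ℝ) (hd : 2 ≤ d) (hq1 : 1 ≤ q) (hqd : q < d)
    (hν : ν ∈ Ioc (0 : ℝ) 1) (hδ : δ ∈ Ioo (0 : ℝ) 1) :
    ∃ N : ℝ, 0 < N ∧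
      ∀ (a : Fin d → Fin d → ℝ → EuclideanSpace ℝ (Fin d) → ℝ)
        (u f : ℝ → EuclideanSpace ℝ (Fin d) → ℝ),
        (∀ i j, Measurable (fun z : ℝ × EuclideanSpace ℝ (Fin d) => a i j z.1 z.2)) →
        (∀ i j t x, a i j t x = a j i t x) →
        UnifEllipticP d ν a →
        (∀ i j (t : ℝ) (x y : EuclideanSpace ℝ (Fin d)),
          (∀ k : Fin d, q ≤ (k : ℕ) → x k = y k) → a i j t x = a i j t y) →
        ParClassical (parQ d 1) u →
        (∀ᵐ z ∂(volume.restrict (parQ d 1)),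
          td u z.1 z.2 - ∑ i, ∑ j, a i j z.1 z.2 * sd2 i j (u z.1) z.2 = f z.1 z.2) →
        ∀ K M : ℝ, 0 ≤ K → PHolderXPar d q δ (parQ d 1) f K →
          (∀ z ∈ parQ d 1, |u z.1 z.2| ≤ M) →
          ∀ i j : Fin d, (i : ℕ) < q → (j : ℕ) < q →
            PHolderXPar d q δ (parQ d (1/2)) (fun t x => sd2 i j (u t) x)
              (N * (K + M)) := by
  obtain ⟨N, hN, hQ⟩ := qf_bound d q ν δ hν.1 hδ.1 hδ.2
  refine ⟨2 * N, by positivity, ?_⟩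
  intro a u f _ hsym hell hind hu heq K M hK hf hM i j hi hj t x y hx hy hxy
  have hM0 : 0 ≤ M := by
    have := hM (-(1 / 2), 0) ⟨⟨by norm_num, by norm_num⟩, by simp⟩
    exact (abs_nonneg _).trans this
  have hx1 : ‖x‖ < 1 / 2 := by simpa using hx.2
  have hy1 : ‖y‖ < 1 / 2 := by simpa using hy.2
  have ht0 : -(1 / 4) < t := by have := hx.1.1; norm_num at this ⊢; exact this
  have ht1 : t < 0 := hx.1.2
  have hcd : ∀ w : EuclideanSpace ℝ (Fin d), ‖w‖ < 1 / 2 → ContDiffAt ℝ 2 (u t) w := by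
    intro w hw
    refine hu.2.1 (t, w) ⟨⟨by norm_num; linarith, ht1⟩, ?_⟩
    simp only [mem_ball, dist_zero_right]
    linarith
  have hni : ‖(EuclideanSpace.single i 1 : EuclideanSpace ℝ (Fin d))‖ = 1 := by simp
  have hnj : ‖(EuclideanSpace.single j 1 : EuclideanSpace ℝ (Fin d))‖ = 1 := by simp
  have main : ∀ η : ℝ, 0 < η →
      |sd2 i j (u t) x - sd2 i j (u t) y| ≤ 2 * N * (K + M + η) * dist x y ^ δ := by
    intro η hη
    have hG : Good d q ν δ (K + M + η) u := by
      refine ⟨hu, ?_, fun z hz => (hM z hz).trans (by linarith)⟩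
      intro t x H hH hHQ
      obtain ⟨A, hA, hAb⟩ := freeze hν.1 hsym hell hind hu heq hf t x H hH hHQ
      refine ⟨A, hA, fun h hh h' hh' => (hAb h hh h' hh').trans ?_⟩
      have : 0 ≤ dist h h' ^ δ := by positivity
      gcongr
      linarith
    have h1 := hQ _ u (by positivity) hG
      ((1 / 2 : ℝ) • (EuclideanSpace.single i 1 + EuclideanSpace.single j 1)) (by
        rw [norm_smul]
        have := norm_add_le (EuclideanSpace.single i 1 : EuclideanSpace ℝ (Fin d))
          (EuclideanSpace.single j 1)
        norm_num
        linarith) (by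
        intro k hk
        have h1 : k ≠ i := fun h => by rw [h] at hk; omega
        have h2 : k ≠ j := fun h => by rw [h] at hk; omega
        simp [h1, h2]) t x y ht0 ht1 hx1 hy1 hxy
    have h2 := hQ _ u (by positivity) hG
      ((1 / 2 : ℝ) • (EuclideanSpace.single i 1 - EuclideanSpace.single j 1)) (by
        rw [norm_smul]
        have := norm_sub_le (EuclideanSpace.single i 1 : EuclideanSpace ℝ (Fin d))
          (EuclideanSpace.single j 1)
        norm_num
        linarith) (by
        intro k hk
        have h1 : k ≠ i := fun h => by rw [h] at hk; omega
        have h2 : k ≠ j := fun h => by rw [h] at hk; omega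
        simp [h1, h2]) t x y ht0 ht1 hx1 hy1 hxy
    rw [sd2_polar (hcd x hx1), sd2_polar (hcd y hy1)]
    rw [abs_le] at h1 h2 ⊢
    constructor <;> linarith [h1.1, h1.2, h2.1, h2.2]
  have hl : Tendsto (fun η : ℝ => 2 * N * (K + M + η) * dist x y ^ δ) (nhdsWithin 0 (Ioi 0))
      (nhds (2 * N * (K + M + 0) * dist x y ^ δ)) := by
    have hc : Continuous (fun η : ℝ => 2 * N * (K + M + η) * dist x y ^ δ) := by fun_prop
    exact (hc.tendsto 0).mono_left nhdsWithin_le_nhds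
  rw [add_zero] at hl
  exact ge_of_tendsto hl (eventually_nhdsWithin_of_forall fun η hη => main η hη)
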